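/- arXiv:1302.1368 — 3 statements merged into one kernel-verified Lean document; each statement's English description precedes it below -/
import Mathlib

section
/- Let n<ω, let A∈S_c Nr_n CA_ω be countable, let κ<cov(K), and let (X_i : i<κ) be a family of subsets of A such that for each i<κ the infimum of X_i in A is 0. Then for every nonzero a∈A there exist a set X and a homomorphism f from A into the full cylindric set algebra of dimension n with base X such that f(a)≠0 and ⋂_{x∈X_i} f(x)=∅ for every i<κ. -/
universe u v w

/-- An algebra of the similarity type of cylindric algebras, with dimensions
indexed by the type `ι`: a carrier with Boolean-type operations `add` (+),
`mul` (·), `neg` (−), constants `zero` (0), `one` (1), cylindrifications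
`c i` and diagonal constants `d i j` (no axioms are assumed). -/
structure RawCA (ι : Type v) : Type (max (u + 1) v) where
  carrier : Type u
  add : carrier → carrier → carrier
  mul : carrier → carrier → carrier
  neg : carrier → carrier
  zero : carrier
  one : carrier
  c : ι → carrier → carrier
  d : ι → ι → carrier

namespace RawCA

variable {ι : Type v}

/-- The Boolean order:  `x ≤ y` iff `x + y = y`. -/
def le (M : RawCA.{u, v} ι) (x y : M.carrier) : Prop := M.add x y = y

/-- `(A, +, ·, −, 0, 1)` is a Boolean algebra (Huntington's axioms). -/
def IsBoolean (M : RawCA.{u, v} ι) : Prop :=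
  (∀ x y, M.add x y = M.add y x) ∧
  (∀ x y, M.mul x y = M.mul y x) ∧
  (∀ x y z, M.add x (M.mul y z) = M.mul (M.add x y) (M.add x z)) ∧
  (∀ x y z, M.mul x (M.add y z) = M.add (M.mul x y) (M.mul x z)) ∧
  (∀ x, M.add x M.zero = x) ∧
  (∀ x, M.mul x M.one = x) ∧
  (∀ x, M.add x (M.neg x) = M.one) ∧
  (∀ x, M.mul x (M.neg x) = M.zero)

/-- `M` is a cylindric algebra of dimension `ι`: a Boolean algebra with the
cylindric axioms (C1)-(C7). -/
def IsCA (M : RawCA.{u, v} ι) : Prop :=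
  M.IsBoolean ∧
  (∀ i, M.c i M.zero = M.zero) ∧
  (∀ i x, M.le x (M.c i x)) ∧
  (∀ i x y, M.c i (M.mul x (M.c i y)) = M.mul (M.c i x) (M.c i y)) ∧
  (∀ i j x, M.c i (M.c j x) = M.c j (M.c i x)) ∧
  (∀ i, M.d i i = M.one) ∧
  (∀ i j k, i ≠ j → i ≠ k → M.d j k = M.c i (M.mul (M.d j i) (M.d i k))) ∧
  (∀ i j x, i ≠ j →
    M.mul (M.c i (M.mul (M.d i j) x)) (M.c i (M.mul (M.d i j) (M.neg x))) = M.zero)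

/-- Homomorphisms for the similarity type of cylindric algebras. -/
def IsHom (M : RawCA.{u, v} ι) (N : RawCA.{w, v} ι) (f : M.carrier → N.carrier) : Prop :=
  (∀ x y, f (M.add x y) = N.add (f x) (f y)) ∧
  (∀ x y, f (M.mul x y) = N.mul (f x) (f y)) ∧
  (∀ x, f (M.neg x) = N.neg (f x)) ∧
  f M.zero = N.zero ∧
  f M.one = N.one ∧
  (∀ i x, f (M.c i x) = N.c i (f x)) ∧
  (∀ i j, f (M.d i j) = N.d i j)

end RawCA

/-- The cylindrification operation on sets of `ι`-sequences. -/
def cylSet (ι U : Type*) (i : ι) (X : Set (ι → U)) : Set (ι → U) :=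
  {s | ∃ t ∈ X, ∀ j, j ≠ i → t j = s j}

/-- The diagonal elements:  sets of `ι`-sequences with equal `i`-th and `j`-th entries. -/
def diagSet (ι U : Type*) (i j : ι) : Set (ι → U) := {s | s i = s j}

/-- The full cylindric set algebra of dimension `ι` with base `U`. -/
def fullSetAlg (ι : Type v) (U : Type u) : RawCA.{max u v, v} ι where
  carrier := Set (ι → U)
  add X Y := X ∪ Y
  mul X Y := X ∩ Y
  neg X := Xᶜ
  zero := ∅
  one := Set.univ
  c := cylSet ι U
  d := diagSet ι U

/-- The direct product of a family of algebras of the cylindric similarity type. -/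
def prodAlg {ι : Type v} {I : Type w} (F : I → RawCA.{u, v} ι) : RawCA.{max u w, v} ι where
  carrier := ∀ i, (F i).carrier
  add f g := fun i => (F i).add (f i) (g i)
  mul f g := fun i => (F i).mul (f i) (g i)
  neg f := fun i => (F i).neg (f i)
  zero := fun i => (F i).zero
  one := fun i => (F i).one
  c j f := fun i => (F i).c j (f i)
  d j k := fun i => (F i).d j k

/-- `M` is a representable cylindric algebra of dimension `ι` (`M ∈ RCA_ι`):
`M` is isomorphic to a subalgebra of a direct product of full cylindric set
algebras of dimension `ι`. -/
def RawCA.Representable {ι : Type v} (M : RawCA.{u, v} ι) : Prop :=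
  ∃ (I : Type max u v) (U : I → Type max u v)
    (f : M.carrier → (prodAlg fun i => fullSetAlg ι (U i)).carrier),
    Function.Injective f ∧ RawCA.IsHom M (prodAlg fun i => fullSetAlg ι (U i)) f

/-- `f` neatly embeds `M` into the `ι`-neat reduct of `C` along the dimension
map `u : ι → κ`:  `f` is an injective homomorphism of `ι`-dimensional
cylindric algebras from `M` into the algebra `Nr C` of `u`-neat elements of
`C` (those fixed by every cylindrification whose index is outside the range
of `u`). -/
def IsNeatEmbedding {ι : Type*} {κ : Type*} (M : RawCA ι) (C : RawCA κ)
    (u : ι → κ) (f : M.carrier → C.carrier) : Prop :=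
  Function.Injective f ∧
  (∀ x y, f (M.add x y) = C.add (f x) (f y)) ∧
  (∀ x y, f (M.mul x y) = C.mul (f x) (f y)) ∧
  (∀ x, f (M.neg x) = C.neg (f x)) ∧
  f M.zero = C.zero ∧
  f M.one = C.one ∧
  (∀ i x, f (M.c i x) = C.c (u i) (f x)) ∧
  (∀ i j, f (M.d i j) = C.d (u i) (u j)) ∧
  (∀ x k, k ∉ Set.range u → C.c k (f x) = f x)

/-- `b` is an upper bound of `X` in `M`. -/
def RawCA.IsUB {ι : Type*} (M : RawCA ι) (X : Set M.carrier) (b : M.carrier) : Prop :=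
  ∀ x ∈ X, M.le x b

/-- `b` is the least upper bound (supremum) of `X` among those elements of
`M` that satisfy `P`. -/
def RawCA.IsLubWithin {ι : Type*} (M : RawCA ι) (P : M.carrier → Prop)
    (X : Set M.carrier) (b : M.carrier) : Prop :=
  P b ∧ M.IsUB X b ∧ ∀ b', P b' → M.IsUB X b' → M.le b b'

/-- `b` is the supremum of `X` in `M`. -/
def RawCA.IsLub {ι : Type*} (M : RawCA ι) (X : Set M.carrier) (b : M.carrier) : Prop :=
  M.IsLubWithin (fun _ => True) X b

/-- `b` is a lower bound of `X` in `M`. -/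
def RawCA.IsLB {ι : Type*} (M : RawCA ι) (X : Set M.carrier) (b : M.carrier) : Prop :=
  ∀ x ∈ X, M.le b x

/-- `b` is the infimum of `X` in `M`. -/
def RawCA.IsGlb {ι : Type*} (M : RawCA ι) (X : Set M.carrier) (b : M.carrier) : Prop :=
  M.IsLB X b ∧ ∀ b', M.IsLB X b' → M.le b' b

/-- `a` is an atom of `M`. -/
def RawCA.IsAtomOf {ι : Type*} (M : RawCA ι) (a : M.carrier) : Prop :=
  a ≠ M.zero ∧ ∀ y, M.le y a → y = M.zero ∨ y = a

/-- `M` is atomic: every nonzero element lies above an atom. -/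
def RawCA.Atomic {ι : Type*} (M : RawCA ι) : Prop :=
  ∀ x, x ≠ M.zero → ∃ a, M.IsAtomOf a ∧ M.le a x

/-- A complete representation of `M`:  an isomorphism of `M` onto a
subalgebra of a full cylindric set algebra of dimension `ι` carrying every
existing supremum to the corresponding union. -/
def RawCA.CompletelyRepresentable {ι : Type v} (M : RawCA.{u, v} ι) : Prop :=
  ∃ (U : Type max u v) (f : M.carrier → Set (ι → U)),
    Function.Injective f ∧ RawCA.IsHom M (fullSetAlg ι U) f ∧
    ∀ (X : Set M.carrier) (b : M.carrier), M.IsLub X b → f b = ⋃ x ∈ X, f x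

/-- An element of `C` is `u`-neat if it is fixed by every cylindrification
whose index lies outside the range of `u`  (the `u`-neat elements form the
neat reduct `Nr C`). -/
def RawCA.IsNeat {ι κ : Type*} (C : RawCA κ) (u : ι → κ) (b : C.carrier) : Prop :=
  ∀ k, k ∉ Set.range u → C.c k b = b

/-- `M ∈ S_c Nr_n CA_ω`:  `M` embeds (as a `CA_n`) into the neat `n`-reduct
of a cylindric algebra `C` of dimension ω in such a way that every subset of
`M` whose supremum in `M` is `1` also has supremum `1` in `Nr_n C`. -/
def memScNrOmega (n : ℕ) (M : RawCA.{u, 0} (Fin n)) : Prop :=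
  ∃ (C : RawCA.{u, 0} ℕ) (f : M.carrier → C.carrier),
    C.IsCA ∧ IsNeatEmbedding M C (fun i : Fin n => (i : ℕ)) f ∧
    ∀ X : Set M.carrier, M.IsLub X M.one →
      C.IsLubWithin (C.IsNeat (fun i : Fin n => (i : ℕ))) (f '' X) C.one

/-- `cov(K)`:  the least cardinal `κ` such that the real line is the union
of `κ` nowhere dense sets. -/
noncomputable def covK : Cardinal.{0} :=
  sInf {κ : Cardinal | ∃ (I : Type) (F : I → Set ℝ),
    Cardinal.mk I = κ ∧ (∀ i, IsNowhereDense (F i)) ∧ (⋃ i, F i) = Set.univ}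


/-- The Boolean algebra structure given by Huntington's axioms. -/
@[reducible] noncomputable def RawCA.IsBoolean.toBooleanAlgebra {ι : Type*} {M : RawCA ι}
    (h : M.IsBoolean) : BooleanAlgebra M.carrier :=
  have add_comm := h.1
  have mul_comm := h.2.1
  have add_mul := h.2.2.1
  have mul_add := h.2.2.2.1
  have add_zero := h.2.2.2.2.1
  have mul_one := h.2.2.2.2.2.1
  have add_neg := h.2.2.2.2.2.2.1
  have mul_neg := h.2.2.2.2.2.2.2
  have add_one : ∀ x, M.add x M.one = M.one := fun x => by
    have := add_mul x M.one (M.neg x)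
    rw [mul_comm M.one, mul_one, add_neg, mul_one] at this
    exact this.symm
  have mul_zero : ∀ x, M.mul x M.zero = M.zero := fun x => by
    have := mul_add x M.zero (M.neg x)
    rw [add_comm M.zero, add_zero, mul_neg, add_zero] at this
    exact this.symm
  have add_absorb : ∀ x y, M.add x (M.mul x y) = x := fun x y => by
    have := mul_add x M.one y
    rw [add_comm M.one, add_one, mul_one] at this
    exact this.symm
  have mul_absorb : ∀ x y, M.mul x (M.add x y) = x := fun x y => by
    have := add_mul x M.zero y
    rw [mul_comm M.zero, mul_zero, add_zero] at this
    exact this.symm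
  have add_cancel : ∀ x y z, M.mul x y = M.mul x z →
      M.mul (M.neg x) y = M.mul (M.neg x) z → y = z := fun x y z h1 h2 => by
    have key : ∀ w, w = M.add (M.mul x w) (M.mul (M.neg x) w) := fun w => by
      rw [mul_comm x, mul_comm (M.neg x), ← mul_add, add_neg, mul_one]
    rw [key y, key z, h1, h2]
  have mul_cancel : ∀ x y z, M.add x y = M.add x z →
      M.add (M.neg x) y = M.add (M.neg x) z → y = z := fun x y z h1 h2 => by
    have key : ∀ w, w = M.mul (M.add x w) (M.add (M.neg x) w) := fun w => by
      rw [add_comm x, add_comm (M.neg x), ← add_mul, mul_neg, add_zero]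
    rw [key y, key z, h1, h2]
  have add_assoc : ∀ x y z, M.add (M.add x y) z = M.add x (M.add y z) := fun x y z => by
    apply add_cancel x
    · rw [mul_absorb, mul_add, mul_absorb, add_absorb]
    · rw [mul_add, mul_add, mul_add _ x, mul_comm _ x, mul_neg, add_comm M.zero, add_zero,
        add_comm M.zero, add_zero, mul_add]
  have mul_assoc : ∀ x y z, M.mul (M.mul x y) z = M.mul x (M.mul y z) := fun x y z => by
    apply mul_cancel x
    · rw [add_absorb, add_mul, add_absorb, mul_absorb]
    · rw [add_mul, add_mul, add_mul _ x, add_comm _ x, add_neg, mul_comm M.one, mul_one,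
        mul_comm M.one, mul_one, add_mul]
  letI : Max M.carrier := ⟨M.add⟩
  letI : Min M.carrier := ⟨M.mul⟩
  letI : Lattice M.carrier :=
    Lattice.mk' add_comm add_assoc mul_comm mul_assoc add_absorb mul_absorb
  { (inferInstance : Lattice M.carrier) with
    le_sup_inf := fun x y z => le_of_eq (add_mul x y z).symm
    compl := M.neg
    sdiff := fun x y => M.mul x (M.neg y)
    himp := fun x y => M.add y (M.neg x)
    sdiff_eq := fun _ _ => rfl
    himp_eq := fun _ _ => rfl
    top := M.one
    bot := M.zero
    inf_compl_le_bot := fun x => le_of_eq (mul_neg x)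
    top_le_sup_compl := fun x => le_of_eq (add_neg x).symm
    le_top := add_one
    bot_le := fun x => (add_comm _ _).trans (add_zero x) }

/-- The cylindric axioms (C1)-(C7), in dimension `ω`, on a Boolean algebra. -/
structure IsCylindric {B : Type*} [BooleanAlgebra B] (c : ℕ → B → B) (d : ℕ → ℕ → B) :
    Prop where
  bot : ∀ i, c i ⊥ = ⊥
  le : ∀ i x, x ≤ c i x
  inf : ∀ i x y, c i (x ⊓ c i y) = c i x ⊓ c i y
  comm : ∀ i j x, c i (c j x) = c j (c i x)
  diag_self : ∀ i, d i i = ⊤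
  diag_trans : ∀ i j k, i ≠ j → i ≠ k → d j k = c i (d j i ⊓ d i k)
  diag_inf : ∀ i j x, i ≠ j → c i (d i j ⊓ x) ⊓ c i (d i j ⊓ xᶜ) = ⊥

namespace IsCylindric

variable {B : Type*} [BooleanAlgebra B] {c : ℕ → B → B} {d : ℕ → ℕ → B}

theorem top (h : IsCylindric c d) (i : ℕ) : c i ⊤ = ⊤ := top_le_iff.1 (h.le i ⊤)

theorem idem (h : IsCylindric c d) (i : ℕ) (x : B) : c i (c i x) = c i x := by
  simpa [h.top] using h.inf i ⊤ x

theorem disjoint_iff (h : IsCylindric c d) (i : ℕ) (x y : B) :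
    Disjoint (c i x) y ↔ Disjoint x (c i y) := by
  have key : ∀ x y, Disjoint x (c i y) → Disjoint (c i x) (c i y) := fun x y hxy => by
    rw [_root_.disjoint_iff] at hxy ⊢
    rw [← h.inf, hxy, h.bot]
  exact ⟨fun H => ((key y x H.symm).mono_right (h.le i x)).symm,
    fun H => (key x y H).mono_right (h.le i y)⟩

theorem compl_fixed (h : IsCylindric c d) {i : ℕ} {x : B} (hx : c i x = x) :
    c i xᶜ = xᶜ := by
  refine le_antisymm ?_ (h.le i _)
  rw [le_compl_iff_disjoint_right, h.disjoint_iff, hx]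
  exact disjoint_compl_left

theorem inf_fixed (h : IsCylindric c d) {i : ℕ} {x y : B} (hx : c i x = x) (hy : c i y = y) :
    c i (x ⊓ y) = x ⊓ y := by
  have := h.inf i x y
  rwa [hx, hy] at this

theorem le_of_fixed (h : IsCylindric c d) {i : ℕ} {x y : B} (hy : c i y = y) (hxy : x ≤ y) :
    c i x ≤ y := by
  have := (h.disjoint_iff i x yᶜ).2 (by
    rw [h.compl_fixed hy]; exact disjoint_compl_right_iff.2 hxy)
  exact disjoint_compl_right_iff.1 this

theorem mono (h : IsCylindric c d) (i : ℕ) {x y : B} (hxy : x ≤ y) : c i x ≤ c i y :=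
  h.le_of_fixed (h.idem i y) (hxy.trans (h.le i y))

theorem inf_of_fixed (h : IsCylindric c d) {i : ℕ} {x y : B} (hy : c i y = y) :
    c i (x ⊓ y) = c i x ⊓ y := by
  have := h.inf i x y
  rwa [hy] at this

theorem eq_bot (h : IsCylindric c d) {i : ℕ} {x : B} (hx : c i x = ⊥) : x = ⊥ :=
  le_bot_iff.1 (hx ▸ h.le i x)

theorem cyl_diag_inf_symm (h : IsCylindric c d) {i j : ℕ} (hij : i ≠ j) :
    c i (d j i ⊓ d i j) = ⊤ := by
  rw [← h.diag_trans i j j hij hij, h.diag_self]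

theorem diag_symm (h : IsCylindric c d) (i j : ℕ) : d i j = d j i := by
  have key : ∀ i j, i ≠ j → d i j ≤ d j i := fun i j hij => by
    have h1 := h.diag_inf i j (d j i) hij
    rw [inf_comm (d i j) (d j i), h.cyl_diag_inf_symm hij, top_inf_eq] at h1
    have := h.eq_bot h1
    rwa [← _root_.disjoint_iff, disjoint_compl_right_iff] at this
  rcases eq_or_ne i j with rfl | hij
  · rfl
  · exact le_antisymm (key i j hij) (key j i hij.symm)

theorem cyl_diag (h : IsCylindric c d) {i j : ℕ} (hij : i ≠ j) : c i (d i j) = ⊤ := by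
  have := h.cyl_diag_inf_symm hij
  rwa [h.diag_symm j i, inf_idem] at this

theorem diag_fixed (h : IsCylindric c d) {i j k : ℕ} (hij : i ≠ j) (hik : i ≠ k) :
    c i (d j k) = d j k := by
  rw [h.diag_trans i j k hij hik, h.idem]

theorem diag_inf_diag_le (h : IsCylindric c d) (i j k : ℕ) : d i j ⊓ d j k ≤ d i k := by
  rcases eq_or_ne j i with rfl | hji
  · exact inf_le_right
  rcases eq_or_ne j k with rfl | hjk
  · exact inf_le_left
  rw [h.diag_trans j i k hji hjk]
  exact h.le j _

end IsCylindric

/-- The substitution operator `s^i_j`. -/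
def cylSubst {B : Type*} [BooleanAlgebra B] (c : ℕ → B → B) (d : ℕ → ℕ → B) (i j : ℕ) (x : B) :
    B :=
  c i (d i j ⊓ x)

namespace IsCylindric

variable {B : Type*} [BooleanAlgebra B] {c : ℕ → B → B} {d : ℕ → ℕ → B}

theorem subst_mono (h : IsCylindric c d) (i j : ℕ) {x y : B} (hxy : x ≤ y) :
    cylSubst c d i j x ≤ cylSubst c d i j y :=
  h.mono i (inf_le_inf_left _ hxy)

theorem subst_fixed (h : IsCylindric c d) {i j : ℕ} (hij : i ≠ j) {x : B} (hx : c i x = x) :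
    cylSubst c d i j x = x := by
  rw [cylSubst, h.inf_of_fixed hx, h.cyl_diag hij, top_inf_eq]

theorem le_subst_iff (h : IsCylindric c d) {i j : ℕ} (hij : i ≠ j) (b x : B) :
    b ≤ cylSubst c d i j x ↔ d i j ⊓ c i b ≤ x := by
  rw [cylSubst]
  constructor
  · intro hb
    have h1 : c i b ≤ c i (d i j ⊓ x) := h.le_of_fixed (h.idem _ _) hb
    have h2 := h.diag_inf i j x hij
    have h3 : Disjoint (d i j ⊓ c i b) xᶜ := by
      have h4 : Disjoint (c i b) (c i (d i j ⊓ xᶜ)) :=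
        (_root_.disjoint_iff.2 h2).mono_left h1
      have h5 := h4.mono_right (h.le i _)
      rw [_root_.disjoint_iff] at h5 ⊢
      rw [← h5]; ac_rfl
    exact disjoint_compl_right_iff.1 h3
  · intro hb
    calc b ≤ c i b := h.le i b
      _ = c i (d i j) ⊓ c i b := by rw [h.cyl_diag hij, top_inf_eq]
      _ = c i (d i j ⊓ c i b) := (h.inf _ _ _).symm
      _ ≤ _ := h.mono i (le_inf inf_le_left hb)

theorem subst_inf (h : IsCylindric c d) {i j : ℕ} (hij : i ≠ j) (x y : B) :
    cylSubst c d i j (x ⊓ y) = cylSubst c d i j x ⊓ cylSubst c d i j y := by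
  refine le_antisymm (le_inf (h.subst_mono i j inf_le_left) (h.subst_mono i j inf_le_right)) ?_
  rw [h.le_subst_iff hij]
  exact le_inf ((h.le_subst_iff hij _ _).1 inf_le_left) ((h.le_subst_iff hij _ _).1 inf_le_right)

theorem subst_bot (h : IsCylindric c d) (i j : ℕ) : cylSubst c d i j ⊥ = ⊥ := by
  rw [cylSubst, inf_bot_eq, h.bot]

theorem subst_compl (h : IsCylindric c d) {i j : ℕ} (hij : i ≠ j) (x : B) :
    cylSubst c d i j xᶜ = (cylSubst c d i j x)ᶜ := by
  refine (IsCompl.compl_eq ⟨?_, ?_⟩).symm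
  · exact _root_.disjoint_iff.2 (h.diag_inf i j x hij)
  · rw [codisjoint_iff, eq_top_iff, ← h.cyl_diag hij]
    refine h.le_of_fixed ?_ ?_
    · have : cylSubst c d i j x ⊔ cylSubst c d i j xᶜ =
          ((cylSubst c d i j x)ᶜ ⊓ (cylSubst c d i j xᶜ)ᶜ)ᶜ := by simp
      rw [this]
      exact h.compl_fixed (h.inf_fixed (h.compl_fixed (h.idem _ _)) (h.compl_fixed (h.idem _ _)))
    · calc d i j = (d i j ⊓ x) ⊔ (d i j ⊓ xᶜ) := by rw [← inf_sup_left, sup_compl_eq_top, inf_top_eq]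
        _ ≤ _ := sup_le_sup (h.le i _) (h.le i _)

theorem subst_cyl_self (h : IsCylindric c d) {i j : ℕ} (hij : i ≠ j) (x : B) :
    cylSubst c d i j (c i x) = c i x :=
  h.subst_fixed hij (h.idem i x)

theorem subst_cyl (h : IsCylindric c d) {i j k : ℕ} (hki : k ≠ i) (hkj : k ≠ j) (x : B) :
    cylSubst c d i j (c k x) = c k (cylSubst c d i j x) := by
  have hd := h.diag_fixed hki hkj
  rw [cylSubst, cylSubst, h.comm k i, inf_comm _ x, h.inf_of_fixed hd, inf_comm]

theorem subst_diag (h : IsCylindric c d) {i j : ℕ} (hij : i ≠ j) (p q : ℕ) :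
    cylSubst c d i j (d p q) = d (if p = i then j else p) (if q = i then j else q) := by
  by_cases hp : p = i <;> by_cases hq : q = i
  · subst hp hq
    rw [if_pos rfl, h.diag_self, h.diag_self]
    exact h.subst_fixed hij (h.top _)
  · subst hp
    rw [if_pos rfl, if_neg hq, cylSubst, h.diag_symm p j, ← h.diag_trans p j q hij (Ne.symm hq)]
  · subst hq
    rw [if_pos rfl, if_neg hp, cylSubst, inf_comm, ← h.diag_trans q p j (Ne.symm hp) hij]
  · rw [if_neg hp, if_neg hq]
    exact h.subst_fixed hij (h.diag_fixed (Ne.symm hp) (Ne.symm hq))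

theorem diag_inf_subst_le (h : IsCylindric c d) {i j m : ℕ} (hij : i ≠ j) (him : i ≠ m) (x : B) :
    d j m ⊓ cylSubst c d i j x ≤ cylSubst c d i m x := by
  rw [cylSubst, inf_comm, ← h.inf_of_fixed (h.diag_fixed hij him)]
  refine h.mono i (le_inf ?_ (inf_le_left.trans inf_le_right))
  exact (le_inf (inf_le_left.trans inf_le_left) inf_le_right).trans (h.diag_inf_diag_le i j m)

end IsCylindric

/-- The simultaneous substitution of `t i` for `i`, for all `i < k`. -/
def cylSubsts {B : Type*} [BooleanAlgebra B] (c : ℕ → B → B) (d : ℕ → ℕ → B) (t : ℕ → ℕ) :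
    ℕ → B → B
  | 0, x => x
  | k + 1, x => cylSubsts c d t k (cylSubst c d k (t k) x)

/-- The elements whose dimension set is finite. -/
def FiniteDim {B : Type*} (c : ℕ → B → B) (b : B) : Prop :=
  ∃ N, ∀ m, N ≤ m → c m b = b

namespace IsCylindric

variable {B : Type*} [BooleanAlgebra B] {c : ℕ → B → B} {d : ℕ → ℕ → B}
  {n k : ℕ} {t : ℕ → ℕ}

theorem finiteDim_inf (h : IsCylindric c d) {x y : B} (hx : FiniteDim c x)
    (hy : FiniteDim c y) : FiniteDim c (x ⊓ y) := by
  obtain ⟨N, hN⟩ := hx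
  obtain ⟨K, hK⟩ := hy
  exact ⟨max N K, fun m hm => h.inf_fixed (hN m (le_trans (le_max_left _ _) hm))
    (hK m (le_trans (le_max_right _ _) hm))⟩

theorem finiteDim_cyl (h : IsCylindric c d) (i : ℕ) {x : B} (hx : FiniteDim c x) :
    FiniteDim c (c i x) := by
  obtain ⟨N, hN⟩ := hx
  exact ⟨N, fun m hm => by rw [h.comm, hN m hm]⟩

theorem finiteDim_diag (h : IsCylindric c d) (i j : ℕ) : FiniteDim c (d i j) :=
  ⟨i + j + 1, fun m hm => h.diag_fixed (by omega) (by omega)⟩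

theorem finiteDim_subst (h : IsCylindric c d) (i j : ℕ) {x : B} (hx : FiniteDim c x) :
    FiniteDim c (cylSubst c d i j x) :=
  h.finiteDim_cyl i (h.finiteDim_inf (h.finiteDim_diag i j) hx)

theorem finiteDim_substs (h : IsCylindric c d) (t : ℕ → ℕ) (k : ℕ) {x : B}
    (hx : FiniteDim c x) : FiniteDim c (cylSubsts c d t k x) := by
  induction k generalizing x with
  | zero => exact hx
  | succ k ih => exact ih (h.finiteDim_subst _ _ hx)

theorem substs_mono (h : IsCylindric c d) (t : ℕ → ℕ) (k : ℕ) {x y : B} (hxy : x ≤ y) :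
    cylSubsts c d t k x ≤ cylSubsts c d t k y := by
  induction k generalizing x y with
  | zero => exact hxy
  | succ k ih => exact ih (h.subst_mono _ _ hxy)

theorem substs_inf (h : IsCylindric c d) (ht : ∀ i, n ≤ t i) (hk : k ≤ n) (x y : B) :
    cylSubsts c d t k (x ⊓ y) = cylSubsts c d t k x ⊓ cylSubsts c d t k y := by
  induction k generalizing x y with
  | zero => rfl
  | succ k ih =>
    have := ht k
    simp only [cylSubsts]
    rw [h.subst_inf (by omega), ih (by omega)]

theorem substs_bot (h : IsCylindric c d) (t : ℕ → ℕ) (k : ℕ) : cylSubsts c d t k ⊥ = ⊥ := by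
  induction k with
  | zero => rfl
  | succ k ih => rw [cylSubsts, h.subst_bot, ih]

theorem substs_compl (h : IsCylindric c d) (ht : ∀ i, n ≤ t i) (hk : k ≤ n) (x : B) :
    cylSubsts c d t k xᶜ = (cylSubsts c d t k x)ᶜ := by
  induction k generalizing x with
  | zero => rfl
  | succ k ih =>
    have := ht k
    simp only [cylSubsts]
    rw [h.subst_compl (by omega), ih (by omega)]

theorem substs_diag (h : IsCylindric c d) (ht : ∀ i, n ≤ t i) (hk : k ≤ n) (p q : ℕ) :
    cylSubsts c d t k (d p q) = d (if p < k then t p else p) (if q < k then t q else q) := by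
  induction k generalizing p q with
  | zero => simp [cylSubsts]
  | succ k ih =>
    have hkt := ht k
    have key : ∀ p, (if (if p = k then t k else p) < k then t (if p = k then t k else p)
        else (if p = k then t k else p)) = if p < k + 1 then t p else p := fun p => by
      rcases lt_trichotomy p k with hp | rfl | hp
      · rw [if_neg (show p ≠ k by omega), if_pos hp, if_pos (by omega)]
      · rw [if_pos rfl, if_neg (by omega), if_pos (by omega)]
      · rw [if_neg (show p ≠ k by omega), if_neg (by omega), if_neg (by omega)]
    rw [cylSubsts, h.subst_diag (by omega), ih (by omega), key, key]

theorem substs_congr (k : ℕ) {t t' : ℕ → ℕ} (htt' : ∀ i < k, t i = t' i) (x : B) :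
    cylSubsts c d t k x = cylSubsts c d t' k x := by
  induction k generalizing x with
  | zero => rfl
  | succ k ih =>
    rw [cylSubsts, cylSubsts, htt' k (by omega), ih fun i hi => htt' i (by omega)]

theorem substs_update_self (t : ℕ → ℕ) (k m : ℕ) (x : B) :
    cylSubsts c d (Function.update t k m) k x = cylSubsts c d t k x :=
  substs_congr k (fun i hi => Function.update_of_ne (by omega) _ _) x

theorem diag_inf_substs_le (h : IsCylindric c d) (ht : ∀ i, n ≤ t i) (hk : k ≤ n) {i m : ℕ}
    (hi : i < k) (hm : n ≤ m) (x : B) :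
    d (t i) m ⊓ cylSubsts c d t k x ≤ cylSubsts c d (Function.update t i m) k x := by
  induction k generalizing x with
  | zero => omega
  | succ k ih =>
    have hkt := ht k
    simp only [cylSubsts]
    rcases eq_or_ne i k with rfl | hik
    · rw [substs_update_self, Function.update_self]
      have hd := h.substs_diag ht (show i ≤ n by omega) (t i) m
      rw [if_neg (by omega), if_neg (by omega)] at hd
      rw [← hd, ← h.substs_inf ht (by omega)]
      exact h.substs_mono _ _ (h.diag_inf_subst_le (by omega) (by omega) x)
    · rw [Function.update_of_ne hik.symm]
      exact ih (by omega) (by omega) _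

theorem substs_update_cyl (h : IsCylindric c d) (ht : ∀ i, n ≤ t i) (hk : k ≤ n) {i m : ℕ}
    (hi : i < k) (hm : n ≤ m) (x : B) :
    cylSubsts c d (Function.update t i m) k (c i x) = cylSubsts c d t k (c i x) := by
  induction k generalizing x with
  | zero => omega
  | succ k ih =>
    have hkt := ht k
    simp only [cylSubsts]
    rcases eq_or_ne i k with rfl | hik
    · rw [substs_update_self, Function.update_self, h.subst_cyl_self (by omega),
        h.subst_cyl_self (by omega)]
    · rw [Function.update_of_ne hik.symm, h.subst_cyl hik (by omega), ih (by omega) (by omega)]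

theorem substs_update_le (h : IsCylindric c d) (ht : ∀ i, n ≤ t i) (hk : k ≤ n) {i m : ℕ}
    (hi : i < k) (hm : n ≤ m) (x : B) :
    cylSubsts c d (Function.update t i m) k x ≤ cylSubsts c d t k (c i x) := by
  rw [← h.substs_update_cyl ht hk hi hm]
  exact h.substs_mono _ _ (h.le i x)

theorem substs_cyl (h : IsCylindric c d) (hk : k ≤ n) {m : ℕ}
    (hm : n ≤ m) (hmt : ∀ i < k, m ≠ t i) (x : B) :
    cylSubsts c d t k (c m x) = c m (cylSubsts c d t k x) := by
  induction k generalizing x with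
  | zero => rfl
  | succ k ih =>
    simp only [cylSubsts]
    rw [h.subst_cyl (by omega) (hmt k (by omega)), ih (by omega) fun i hi => hmt i (by omega)]

theorem substs_cyl_eq (h : IsCylindric c d) (ht : ∀ i, n ≤ t i) (hk : k ≤ n) {i m : ℕ}
    (hi : i < k) (hm : n ≤ m) (hmt : ∀ i < k, m ≠ t i) {x : B} (hx : c m x = x) :
    cylSubsts c d t k (c i x) = c m (cylSubsts c d (Function.update t i m) k x) := by
  induction k generalizing x with
  | zero => omega
  | succ k ih =>
    have hkt := ht k
    simp only [cylSubsts]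
    rcases eq_or_ne i k with rfl | hik
    · rw [substs_update_self, Function.update_self, h.subst_cyl_self (by omega),
        ← h.substs_cyl (show i ≤ n by omega) hm fun i hi => hmt i (by omega), cylSubst,
        h.comm m i, inf_comm, inf_comm, h.inf_of_fixed hx, h.diag_symm,
        h.cyl_diag (by omega), top_inf_eq]
    · rw [Function.update_of_ne hik.symm, h.subst_cyl hik (by omega),
        ih (by omega) (by omega) fun i hi => hmt i (by omega)]
      rw [← h.subst_cyl (by omega) (hmt k (by omega)), hx]

theorem substs_add_ne_bot (h : IsCylindric c d) (hk : k ≤ n) {x : B} (hx : x ≠ ⊥)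
    (hfix : ∀ m, n ≤ m → m < n + k → c m x = x) :
    cylSubsts c d (fun i => n + i) k x ≠ ⊥ := by
  induction k generalizing x with
  | zero => exact hx
  | succ k ih =>
    refine ih (by omega) (fun h0 => hx ?_) fun m hm hmk => ?_
    · have h1 := congrArg (c (n + k)) (h.eq_bot h0)
      rwa [h.inf_of_fixed (hfix _ (by omega) (by omega)), h.diag_symm, h.cyl_diag (by omega),
        top_inf_eq, h.bot] at h1
    · rw [← h.subst_cyl (show m ≠ k by omega) (show m ≠ n + k by omega), hfix m hm (by omega)]

theorem eq_bot_of_le_substs (h : IsCylindric c d) (ht : ∀ i, n ≤ t i) (hk : k ≤ n)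
    {X : Set B} (hX : ∀ b, FiniteDim c b → (∀ x ∈ X, b ≤ x) → b = ⊥) {b : B}
    (hb : FiniteDim c b) (hbX : ∀ x ∈ X, b ≤ cylSubsts c d t k x) : b = ⊥ := by
  induction k generalizing X with
  | zero => exact hX b hb hbX
  | succ k ih =>
    have hkt : k ≠ t k := by have := ht k; omega
    refine ih (by omega) (X := cylSubst c d k (t k) '' X) (fun b' hb' hbX' => ?_) ?_
    · have := hX _ (h.finiteDim_inf (h.finiteDim_diag k (t k)) (h.finiteDim_cyl k hb'))
        fun x hx => (h.le_subst_iff hkt _ _).1 (hbX' _ ⟨x, hx, rfl⟩)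
      have h1 := congrArg (c k) this
      rw [h.inf, h.cyl_diag hkt, top_inf_eq, h.bot] at h1
      exact h.eq_bot h1
    · rintro _ ⟨x, hx, rfl⟩
      exact hbX x hx

theorem exists_neat_ge (h : IsCylindric c d) (n : ℕ) {b : B} (hb : FiniteDim c b) :
    ∃ b', b ≤ b' ∧ (∀ m, n ≤ m → c m b' = b') ∧
      ∀ x, (∀ m, n ≤ m → c m x = x) → b ≤ x → b' ≤ x := by
  obtain ⟨N, hN⟩ := hb
  suffices H : ∀ k b, (∀ m, n + k ≤ m → c m b = b) →
      ∃ b', b ≤ b' ∧ (∀ m, n ≤ m → c m b' = b') ∧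
        ∀ x, (∀ m, n ≤ m → c m x = x) → b ≤ x → b' ≤ x from
    H N b fun m hm => hN m (by omega)
  intro k
  induction k with
  | zero => exact fun b hb => ⟨b, le_rfl, hb, fun x _ hx => hx⟩
  | succ k ih =>
    intro b hb
    obtain ⟨b', hbb', hfix, hmin⟩ := ih (c (n + k) b) fun m hm => by
      rcases eq_or_ne m (n + k) with rfl | hmk
      · exact h.idem _ _
      · rw [h.comm, hb m (by omega)]
    exact ⟨b', (h.le _ _).trans hbb', hfix,
      fun x hx hbx => hmin x hx (h.le_of_fixed (hx _ (by omega)) hbx)⟩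

end IsCylindric

theorem covK_mem : ∃ (I : Type) (F : I → Set ℝ),
    Cardinal.mk I = covK ∧ (∀ i, IsNowhereDense (F i)) ∧ (⋃ i, F i) = Set.univ := by
  refine csInf_mem (s := {κ : Cardinal | ∃ (I : Type) (F : I → Set ℝ),
    Cardinal.mk I = κ ∧ (∀ i, IsNowhereDense (F i)) ∧ (⋃ i, F i) = Set.univ})
    ⟨Cardinal.mk ℝ, ℝ, fun x => {x}, rfl, fun x => ?_, ?_⟩
  · simp [IsNowhereDense]
  · ext x; simp

theorem exists_notMem_of_mk_lt_covK {I : Type} (hI : Cardinal.mk I < covK) {F : I → Set ℝ}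
    (hF : ∀ i, IsNowhereDense (F i)) : ∃ x, ∀ i, x ∉ F i := by
  by_contra! hcon
  refine not_le.2 hI (csInf_le' ?_)
  exact ⟨I, F, rfl, hF, Set.eq_univ_of_forall fun x => by simpa using hcon x⟩

theorem aleph0_lt_covK : Cardinal.aleph0 < covK := by
  by_contra! hcon
  obtain ⟨I, F, hI, hF, hU⟩ := covK_mem
  have : Countable I := Cardinal.mk_le_aleph0_iff.1 (hI ▸ hcon)
  obtain ⟨i, hi⟩ := nonempty_interior_of_iUnion_of_closed (f := fun i => closure (F i))
    (fun i => isClosed_closure)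
    (Set.eq_univ_of_univ_subset (hU ▸ Set.iUnion_mono fun i => subset_closure))
  rw [hF i] at hi
  exact Set.not_nonempty_empty hi

/-- The run of an automaton reading the binary digits of a real number. -/
noncomputable def binaryRun {S : Type*} (step : S → Bool → S) (s₀ : S) (x : ℝ) : ℕ → S
  | 0 => s₀
  | k + 1 => step (binaryRun step s₀ x k) (decide (⌊(2 : ℝ) ^ (k + 1) * x⌋ % 2 = 1))

theorem floor_two_pow_succ_mul_div_two (k : ℕ) (x : ℝ) :
    ⌊(2 : ℝ) ^ (k + 1) * x⌋ / 2 = ⌊(2 : ℝ) ^ k * x⌋ := by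
  have := Int.floor_div_natCast ((2 : ℝ) ^ (k + 1) * x) 2
  rw [Nat.cast_ofNat, Nat.cast_ofNat] at this
  rw [← this]
  congr 1
  ring

theorem binaryRun_congr {S : Type*} (step : S → Bool → S) (s₀ : S) (k : ℕ) {x y : ℝ}
    (hxy : ⌊(2 : ℝ) ^ k * x⌋ = ⌊(2 : ℝ) ^ k * y⌋) :
    binaryRun step s₀ x k = binaryRun step s₀ y k := by
  induction k with
  | zero => rfl
  | succ k ih =>
    rw [binaryRun, binaryRun, hxy, ih]
    rw [← floor_two_pow_succ_mul_div_two, hxy, floor_two_pow_succ_mul_div_two]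

theorem exists_dyadic_subset {V : Set ℝ} (hV : IsOpen V) (hne : V.Nonempty) :
    ∃ (k : ℕ) (a : ℤ), {x : ℝ | ⌊(2 : ℝ) ^ k * x⌋ = a} ⊆ V := by
  obtain ⟨x, hx⟩ := hne
  obtain ⟨ε, hε, hball⟩ := Metric.isOpen_iff.1 hV x hx
  obtain ⟨k, hk⟩ := exists_pow_lt_of_lt_one hε (show (1 / 2 : ℝ) < 1 by norm_num)
  refine ⟨k, ⌊(2 : ℝ) ^ k * x⌋, fun y hy => hball ?_⟩
  have h1 := Int.abs_sub_lt_one_of_floor_eq_floor (show ⌊(2 : ℝ) ^ k * y⌋ = ⌊(2 : ℝ) ^ k * x⌋ from hy)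
  have hpos : (0 : ℝ) < 2 ^ k := by positivity
  rw [← mul_sub, abs_mul, abs_of_pos hpos] at h1
  rw [Metric.mem_ball, Real.dist_eq]
  refine lt_of_lt_of_le ?_ hk.le
  rwa [one_div_pow, lt_div_iff₀ hpos, mul_comm]

/-- From any dyadic interval, an automaton can be driven along any word. -/
theorem exists_dyadic_foldl {S : Type*} (step : S → Bool → S) (s₀ : S) (w : List Bool)
    (k : ℕ) (a : ℤ) (s : S) (hs : ∀ x : ℝ, ⌊(2 : ℝ) ^ k * x⌋ = a → binaryRun step s₀ x k = s) :
    ∃ (l : ℕ) (b : ℤ), ∀ x : ℝ, ⌊(2 : ℝ) ^ l * x⌋ = b →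
      ⌊(2 : ℝ) ^ k * x⌋ = a ∧ binaryRun step s₀ x l = w.foldl step s := by
  induction w generalizing k a s with
  | nil => exact ⟨k, a, fun x hx => ⟨hx, hs x hx⟩⟩
  | cons e w ih =>
    have hfl : ∀ x : ℝ, ⌊(2 : ℝ) ^ (k + 1) * x⌋ = 2 * a + (if e then 1 else 0) →
        ⌊(2 : ℝ) ^ k * x⌋ = a := fun x hx => by
      rw [← floor_two_pow_succ_mul_div_two, hx]
      split <;> omega
    obtain ⟨l, b, hb⟩ := ih (k + 1) (2 * a + if e then 1 else 0) (step s e) fun x hx => by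
      rw [binaryRun, hs x (hfl x hx), hx]
      congr 1
      cases e <;> simp
    exact ⟨l, b, fun x hx => ⟨hfl x (hb x hx).1, (hb x hx).2⟩⟩

theorem isNowhereDense_binaryRun {S : Type*} (step : S → Bool → S) (s₀ : S) (T : Set S)
    (hT : ∀ s, ∃ w : List Bool, w.foldl step s ∈ T) :
    IsNowhereDense {x : ℝ | ∀ k, binaryRun step s₀ x k ∉ T} := by
  rw [IsNowhereDense, ← Set.not_nonempty_iff_eq_empty]
  intro hne
  obtain ⟨k, a, hka⟩ := exists_dyadic_subset isOpen_interior hne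
  have hpos : ∀ k : ℕ, (0 : ℝ) < 2 ^ k := fun k => by positivity
  have hmem : ∀ (k : ℕ) (a : ℤ), ⌊(2 : ℝ) ^ k * ((a + 1 / 2) / 2 ^ k)⌋ = a := fun k a => by
    rw [mul_div_cancel₀ _ (hpos k).ne', Int.floor_eq_iff]
    constructor <;> linarith
  obtain ⟨w, hw⟩ := hT (binaryRun step s₀ ((a + 1 / 2) / 2 ^ k) k)
  obtain ⟨l, b, hb⟩ := exists_dyadic_foldl step s₀ w k a _ fun x hx =>
    binaryRun_congr step s₀ k (hx.trans (hmem k a).symm)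
  have hcl := interior_subset (hka (hb _ (hmem l b)).1)
  obtain ⟨y, hy, hyT⟩ := mem_closure_iff.1 hcl {y : ℝ | (b : ℝ) < 2 ^ l * y ∧ 2 ^ l * y < b + 1}
    ((isOpen_lt continuous_const (continuous_const.mul continuous_id)).inter
      (isOpen_lt (continuous_const.mul continuous_id) continuous_const))
    (by
      constructor <;> rw [mul_div_cancel₀ _ (hpos l).ne'] <;> linarith)
  have := hb y (Int.floor_eq_iff.2 ⟨hy.1.le, hy.2⟩)
  exact hyT l (this.2 ▸ hw)

/-- Fewer than `cov(K)` one-step reachable goals can all be met by a single sequence of moves. -/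
theorem exists_generic_sequence {S : Type*} (move : ℕ → S → S) (s₀ : S) {I : Type}
    (hI : Cardinal.mk I < covK) (R : I → Set S)
    (hR : ∀ i s, s ∈ R i ∨ ∃ m, move m s ∈ R i) :
    ∃ u : ℕ → S, u 0 = s₀ ∧ (∀ k, u (k + 1) = u k ∨ ∃ m, u (k + 1) = move m (u k)) ∧
      ∀ i, ∃ k, u k ∈ R i := by
  let step : S × ℕ → Bool → S × ℕ := fun p e =>
    if e then (p.1, p.2 + 1) else (move p.2 p.1, 0)
  have hcount : ∀ m s l, (List.replicate m true).foldl step (s, l) = (s, l + m) := fun m => by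
    induction m with
    | zero => simp
    | succ m ih =>
      intro s l
      rw [List.replicate_succ, List.foldl_cons, show step (s, l) true = (s, l + 1) from rfl, ih]
      congr 1; omega
  obtain ⟨x, hx⟩ := exists_notMem_of_mk_lt_covK hI fun i =>
    isNowhereDense_binaryRun step (s₀, 0) {p | p.1 ∈ R i} fun ⟨s, l⟩ => by
      rcases hR i (move l s) with h | ⟨m, hm⟩
      · exact ⟨[false], h⟩
      · refine ⟨false :: (List.replicate m true ++ [false]), ?_⟩
        rw [List.foldl_cons, show step (s, l) false = (move l s, 0) from rfl, List.foldl_append,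
          hcount, Nat.zero_add]
        exact hm
  refine ⟨fun k => (binaryRun step (s₀, 0) x k).1, rfl, fun k => ?_, fun i => ?_⟩
  · simp only [binaryRun]
    cases decide (⌊(2 : ℝ) ^ (k + 1) * x⌋ % 2 = 1)
    · exact Or.inr ⟨_, rfl⟩
    · exact Or.inl rfl
  · simpa using hx i

/-- The substitution sending the dimension `i < n` to the dimension `n + τ i`. -/
def shiftSubst (n : ℕ) (τ : Fin n → ℕ) (i : ℕ) : ℕ :=
  n + if hi : i < n then τ ⟨i, hi⟩ else 0

theorem le_shiftSubst (n : ℕ) (τ : Fin n → ℕ) (i : ℕ) : n ≤ shiftSubst n τ i :=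
  Nat.le_add_right _ _

theorem shiftSubst_coe {n : ℕ} (τ : Fin n → ℕ) (i : Fin n) : shiftSubst n τ i = n + τ i := by
  simp [shiftSubst]

theorem shiftSubst_update {n : ℕ} (τ : Fin n → ℕ) (i : Fin n) (m : ℕ) :
    shiftSubst n (Function.update τ i m) = Function.update (shiftSubst n τ) i (n + m) := by
  ext p
  rcases eq_or_ne p i with rfl | hp
  · rw [Function.update_self, shiftSubst_coe, Function.update_self]
  · rw [Function.update_of_ne hp, shiftSubst, shiftSubst]
    split
    · rw [Function.update_of_ne (by rintro rfl; exact hp rfl)]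
    · rfl

/-- A Henkin filter deciding all substituted elements of the family `φ` and omitting the
substitution instances of each `X j`. -/
theorem IsCylindric.exists_henkin_filter {B : Type} [BooleanAlgebra B] {c : ℕ → B → B}
    {d : ℕ → ℕ → B} (h : IsCylindric c d) (n : ℕ) {A : Type} [Countable A] (φ : A → B)
    (hφ : ∀ x m, n ≤ m → c m (φ x) = φ x) (hcompl : ∀ x, ∃ y, φ y = (φ x)ᶜ)
    {J : Type} (hJ : Cardinal.mk J < covK) (X : J → Set A)
    (hX : ∀ j b, (∀ m, n ≤ m → c m b = b) → (∀ x ∈ X j, b ≤ φ x) → b = ⊥)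
    (a : A) (ha : φ a ≠ ⊥) :
    ∃ F : Set B, (∀ x ∈ F, ∀ y, x ≤ y → y ∈ F) ∧ (∀ x ∈ F, ∀ y ∈ F, x ⊓ y ∈ F) ∧ ⊥ ∉ F ∧
      (∀ τ x, cylSubsts c d (shiftSubst n τ) n (φ x) ∈ F ∨
        (cylSubsts c d (shiftSubst n τ) n (φ x))ᶜ ∈ F) ∧
      (∀ τ (i : Fin n) x, cylSubsts c d (shiftSubst n τ) n (c i (φ x)) ∈ F →
        ∃ m, cylSubsts c d (shiftSubst n (Function.update τ i m)) n (φ x) ∈ F) ∧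
      (∃ τ, cylSubsts c d (shiftSubst n τ) n (φ a) ∈ F) ∧
      ∀ j τ, ∃ x ∈ X j, cylSubsts c d (shiftSubst n τ) n (φ x) ∉ F := by
  classical
  have hfin : ∀ τ x, FiniteDim c (cylSubsts c d (shiftSubst n τ) n (φ x)) := fun τ x =>
    h.finiteDim_substs _ _ ⟨n, hφ x⟩
  have hne : cylSubsts c d (shiftSubst n fun i => i) n (φ a) ≠ ⊥ := by
    rw [substs_congr n (t' := fun i => n + i) fun i hi => by simp [shiftSubst, hi]]
    exact h.substs_add_ne_bot le_rfl ha fun m hm _ => hφ a m hm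
  let g : (Fin n → ℕ) × A → B := fun p => cylSubsts c d (shiftSubst n p.1) n (φ p.2)
  have : Nonempty ((Fin n → ℕ) × A) := ⟨(0, a)⟩
  obtain ⟨e, he⟩ := exists_surjective_nat ((Fin n → ℕ) × A)
  let S := {b : B // b ≠ ⊥ ∧ FiniteDim c b}
  let move : ℕ → S → S := fun m s =>
    if hs : s.1 ⊓ g (e m) ≠ ⊥ then ⟨s.1 ⊓ g (e m), hs, h.finiteDim_inf s.2.2 (hfin _ _)⟩ else s
  have hmove_le : ∀ m s, (move m s).1 ≤ s.1 := fun m s => by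
    simp only [move]
    split
    · exact inf_le_left
    · exact le_rfl
  have hmove : ∀ τ x (s : S), s.1 ⊓ cylSubsts c d (shiftSubst n τ) n (φ x) ≠ ⊥ →
      ∃ m, (move m s).1 ≤ cylSubsts c d (shiftSubst n τ) n (φ x) := fun τ x s hs => by
    obtain ⟨m, hm⟩ := he (τ, x)
    refine ⟨m, ?_⟩
    have hs' : s.1 ⊓ g (e m) ≠ ⊥ := by rw [hm]; exact hs
    simp only [move, dif_pos hs', hm]
    exact inf_le_right
  let I := ((Fin n → ℕ) × A) ⊕ ((Fin n → ℕ) × Fin n × A) ⊕ (J × (Fin n → ℕ))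
  let R : I → Set S := fun r => r.elim
    (fun p => {s | s.1 ≤ g p ∨ s.1 ≤ (g p)ᶜ})
    (fun r => r.elim
      (fun p => {s | s.1 ⊓ cylSubsts c d (shiftSubst n p.1) n (c p.2.1 (φ p.2.2)) = ⊥ ∨
        ∃ m, s.1 ≤ cylSubsts c d (shiftSubst n (Function.update p.1 p.2.1 m)) n (φ p.2.2)})
      (fun p => {s | ∃ x ∈ X p.1, s.1 ≤ (cylSubsts c d (shiftSubst n p.2) n (φ x))ᶜ}))
  have hI : Cardinal.mk I < covK := by
    have h0 := aleph0_lt_covK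
    have hlt : ∀ (T : Type) [Countable T], Cardinal.mk T < covK := fun T _ =>
      Cardinal.mk_le_aleph0.trans_lt h0
    simp only [I, Cardinal.mk_sum, Cardinal.lift_id]
    refine Cardinal.add_lt_of_lt h0.le (hlt _) (Cardinal.add_lt_of_lt h0.le (hlt _) ?_)
    rw [Cardinal.mk_prod, Cardinal.lift_id, Cardinal.lift_id]
    exact Cardinal.mul_lt_of_lt h0.le hJ (hlt _)
  obtain ⟨u, hu0, hus, huR⟩ := exists_generic_sequence move
    ⟨cylSubsts c d (shiftSubst n fun i => i) n (φ a), hne, hfin _ _⟩ hI R (by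
      rintro (⟨τ, x⟩ | ⟨τ, i, x⟩ | ⟨j, τ⟩) s
      · by_cases hs : s.1 ⊓ g (τ, x) = ⊥
        · exact Or.inl (Or.inr (le_compl_iff_disjoint_right.2 (_root_.disjoint_iff.2 hs)))
        · obtain ⟨m, hm⟩ := hmove τ x s hs
          exact Or.inr ⟨m, Or.inl hm⟩
      · by_cases hs : ∃ m, s.1 ⊓
            cylSubsts c d (shiftSubst n (Function.update τ i m)) n (φ x) ≠ ⊥
        · obtain ⟨m, hs⟩ := hs
          obtain ⟨k, hk⟩ := hmove _ x s hs
          exact Or.inr ⟨k, Or.inr ⟨m, hk⟩⟩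
        · push Not at hs
          refine Or.inl (Or.inl ?_)
          obtain ⟨N, hN⟩ := s.2.2
          obtain ⟨m, hm⟩ : ∃ m, N ≤ m ∧ ∀ p, τ p < m := by
            refine ⟨N + ∑ p, τ p + 1, by omega, fun p => ?_⟩
            have := Finset.single_le_sum (f := τ) (fun _ _ => Nat.zero_le _) (Finset.mem_univ p)
            omega
          change s.1 ⊓ cylSubsts c d (shiftSubst n τ) n (c i (φ x)) = ⊥
          rw [h.substs_cyl_eq (le_shiftSubst n τ) le_rfl i.2 (Nat.le_add_right n m)
            (fun p hp => ?_) (hφ x _ (Nat.le_add_right n m)), ← shiftSubst_update,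
            ← _root_.disjoint_iff, ← h.disjoint_iff, hN _ (by omega), _root_.disjoint_iff]
          · exact hs m
          · have h1 := shiftSubst_coe τ ⟨p, hp⟩
            have h2 := hm.2 ⟨p, hp⟩
            simp only at h1
            omega
      · obtain ⟨x, hx, hsx⟩ : ∃ x ∈ X j, ¬ s.1 ≤ cylSubsts c d (shiftSubst n τ) n (φ x) := by
          by_contra! hcon
          refine s.2.1 (h.eq_bot_of_le_substs (le_shiftSubst n τ) le_rfl (X := φ '' X j)
            (fun b hb hbX => ?_) s.2.2 (by simpa using hcon))
          obtain ⟨b', hbb', hb', hmin⟩ := h.exists_neat_ge n hb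
          rw [hX j b' hb' fun x hx => hmin _ (hφ x) (hbX _ ⟨x, hx, rfl⟩)] at hbb'
          exact le_bot_iff.1 hbb'
        obtain ⟨y, hy⟩ := hcompl x
        have hS := h.substs_compl (le_shiftSubst n τ) le_rfl (φ x)
        rw [← hy] at hS
        obtain ⟨m, hm⟩ := hmove τ y s (by
          rw [hS, Ne, ← _root_.disjoint_iff, disjoint_compl_right_iff]
          exact hsx)
        exact Or.inr ⟨m, x, hx, hm.trans hS.le⟩)
  have hanti : ∀ k l, k ≤ l → (u l).1 ≤ (u k).1 := fun k l hkl => by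
    induction l, hkl using Nat.le_induction with
    | base => exact le_rfl
    | succ l _ ih =>
      refine le_trans ?_ ih
      rcases hus l with h1 | ⟨m, h1⟩ <;> rw [h1]
      exact hmove_le _ _
  have hconsistent : ∀ k l x y, (u k).1 ≤ x → (u l).1 ≤ y → x ⊓ y ≠ ⊥ := fun k l x y hx hy h0 =>
    (u (max k l)).2.1 (le_bot_iff.1 ((le_inf ((hanti _ _ (le_max_left _ _)).trans hx)
      ((hanti _ _ (le_max_right _ _)).trans hy)).trans h0.le))
  refine ⟨{y | ∃ k, (u k).1 ≤ y}, ?_, ?_, ?_, ?_, ?_, ?_, ?_⟩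
  · rintro x ⟨k, hk⟩ y hxy
    exact ⟨k, hk.trans hxy⟩
  · rintro x ⟨k, hk⟩ y ⟨l, hl⟩
    exact ⟨max k l, le_inf ((hanti _ _ (le_max_left _ _)).trans hk)
      ((hanti _ _ (le_max_right _ _)).trans hl)⟩
  · rintro ⟨k, hk⟩
    exact (u k).2.1 (le_bot_iff.1 hk)
  · intro τ x
    obtain ⟨k, hk | hk⟩ := huR (Sum.inl (τ, x))
    · exact Or.inl ⟨k, hk⟩
    · exact Or.inr ⟨k, hk⟩
  · rintro τ i x ⟨l, hl⟩
    obtain ⟨k, hk | ⟨m, hm⟩⟩ := huR (Sum.inr (Sum.inl (τ, i, x)))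
    · exact absurd hk (hconsistent k l _ _ le_rfl hl)
    · exact ⟨m, k, hm⟩
  · exact ⟨fun i => i, 0, by rw [hu0]⟩
  · intro j τ
    obtain ⟨k, x, hx, hk⟩ := huR (Sum.inr (Sum.inr (j, τ)))
    refine ⟨x, hx, ?_⟩
    rintro ⟨l, hl⟩
    exact hconsistent k l _ _ hk hl (compl_inf_self _)

/-- The cylindric axioms of an `ω`-dimensional algebra over its Boolean algebra structure. -/
theorem RawCA.IsCA.isCylindric {C : RawCA ℕ} (h : C.IsCA) :
    letI := h.1.toBooleanAlgebra
    IsCylindric (B := C.carrier) C.c C.d := by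
  let := h.1.toBooleanAlgebra
  obtain ⟨_, h1, h2, h3, h4, h5, h6, h7⟩ := h
  exact ⟨h1, h2, h3, h4, h5, h6, h7⟩

/-- Let `n < ω`, let `A ∈ S_c Nr_n CA_ω` be countable, let `κ < cov(K)`,
and let `(X_i : i < κ)` be a family of subsets of `A` each with infimum `0`
in `A`.  Then for every nonzero `a ∈ A` there are a set `U` and a
homomorphism `f` from `A` into the full cylindric set algebra of dimension
`n` with base `U` such that `f a ≠ 0` and `⋂_{x ∈ X_i} f x = ∅` for every
`i < κ`. -/
theorem omitting_types_below_covK (n : ℕ) (A : RawCA.{0, 0} (Fin n))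
    (hA : A.IsCA) (hmem : memScNrOmega n A) (hcount : Countable A.carrier)
    (J : Type) (hJ : Cardinal.mk J < covK) (X : J → Set A.carrier)
    (hX : ∀ j, A.IsGlb (X j) A.zero) (a : A.carrier) (ha : a ≠ A.zero) :
    ∃ (U : Type) (f : A.carrier → Set (Fin n → U)),
      RawCA.IsHom A (fullSetAlg (Fin n) U) f ∧ f a ≠ ∅ ∧
      ∀ j, (⋂ x ∈ X j, f x) = ∅ := by
  obtain ⟨C, φ, hC, ⟨hinj, hadd, hmul, hneg, hzero, hone, hcyl, hdiag, hneat⟩, hsup⟩ := hmem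
  have h := hC.isCylindric
  let := hC.1.toBooleanAlgebra
  let : BooleanAlgebra A.carrier := hA.1.toBooleanAlgebra
  have hneat' : ∀ x m, n ≤ m → C.c m (φ x) = φ x := fun x m hm =>
    hneat x m (by rintro ⟨i, rfl⟩; exact absurd i.2 (not_lt.2 hm))
  have hXC : ∀ j b, (∀ m, n ≤ m → C.c m b = b) → (∀ x ∈ X j, b ≤ φ x) → b = ⊥ := by
    intro j b hb hbX
    have hlub : A.IsLub (A.neg '' X j) A.one := by
      refine ⟨trivial, fun x _ => le_top (a := x), fun y _ hy => ?_⟩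
      have hy' : A.IsLB (X j) (yᶜ : A.carrier) := fun x hx => by
        change (yᶜ : A.carrier) ≤ x
        exact compl_le_of_compl_le (hy _ ⟨x, hx, rfl⟩)
      have hle : (yᶜ : A.carrier) ≤ ⊥ := (hX j).2 _ hy'
      exact compl_le_compl_iff_le.1 (hle.trans bot_le)
    have htop : (⊤ : C.carrier) ≤ bᶜ := (hsup _ hlub).2.2 _
      (fun m hm => h.compl_fixed (hb m (not_lt.1 fun hmn => hm ⟨⟨m, hmn⟩, rfl⟩))) (by
        rintro _ ⟨_, ⟨x, hx, rfl⟩, rfl⟩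
        rw [hneg]
        exact compl_le_compl (hbX x hx))
    exact compl_eq_top.1 (top_le_iff.1 htop)
  obtain ⟨F, hup, hinf, hbot, hdec, hwit, ⟨τ₀, hτ₀⟩, homit⟩ := h.exists_henkin_filter n φ hneat'
    (fun x => ⟨A.neg x, hneg x⟩) hJ X hXC a fun h0 => ha (hinj (h0.trans hzero.symm))
  have htop : ⊤ ∈ F := hup _ hτ₀ _ le_top
  let E : Setoid ℕ :=
    { r := fun k m => C.d (n + k) (n + m) ∈ F
      iseqv :=
        { refl := fun k => by rw [h.diag_self]; exact htop
          symm := fun {k m} hkm => by rw [h.diag_symm]; exact hkm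
          trans := fun {k m l} hkm hml => hup _ (hinf _ hkm _ hml) _ (h.diag_inf_diag_le _ _ _) } }
  let S : (Fin n → ℕ) → A.carrier → C.carrier := fun τ x =>
    cylSubsts C.c C.d (shiftSubst n τ) n (φ x)
  have hSmul : ∀ τ x y, S τ (A.mul x y) = S τ x ⊓ S τ y := fun τ x y => by
    simp only [S, hmul]
    exact h.substs_inf (le_shiftSubst n τ) le_rfl _ _
  have hSneg : ∀ τ x, S τ (A.neg x) = (S τ x)ᶜ := fun τ x => by
    simp only [S, hneg]
    exact h.substs_compl (le_shiftSubst n τ) le_rfl _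
  have hSnotMem : ∀ τ x, (S τ x)ᶜ ∈ F ↔ S τ x ∉ F := fun τ x =>
    ⟨fun h1 h2 => hbot (inf_compl_self (S τ x) ▸ hinf _ h2 _ h1), (hdec τ x).resolve_left⟩
  have hSinf : ∀ τ x y, S τ x ⊓ S τ y ∈ F ↔ S τ x ∈ F ∧ S τ y ∈ F := fun τ x y =>
    ⟨fun h1 => ⟨hup _ h1 _ inf_le_left, hup _ h1 _ inf_le_right⟩, fun h1 => hinf _ h1.1 _ h1.2⟩
  let f : A.carrier → Set (Fin n → Quotient E) := fun x => {s | S (fun i => (s i).out) x ∈ F}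
  have hfmul : ∀ x y, f (A.mul x y) = f x ∩ f y := fun x y => by
    ext s
    change S _ _ ∈ F ↔ S _ _ ∈ F ∧ S _ _ ∈ F
    rw [hSmul, hSinf]
  have hfneg : ∀ x, f (A.neg x) = (f x)ᶜ := fun x => by
    ext s
    change S _ _ ∈ F ↔ S _ _ ∉ F
    rw [hSneg, hSnotMem]
  have hfzero : f A.zero = ∅ := by
    refine Set.eq_empty_of_forall_notMem fun s hs => hbot ?_
    have h0 : φ A.zero = (⊥ : C.carrier) := hzero
    change cylSubsts C.c C.d _ n (φ A.zero) ∈ F at hs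
    rwa [h0, h.substs_bot] at hs
  have hSdiag : ∀ τ (i : Fin n) (m : ℕ) x, C.d (n + τ i) (n + m) ∈ F → S τ x ∈ F →
      S (Function.update τ i m) x ∈ F := fun τ i m x hd hS => by
    refine hup _ (hinf _ hd _ hS) _ ?_
    have := h.diag_inf_substs_le (le_shiftSubst n τ) le_rfl i.2 (Nat.le_add_right n m) (φ x)
    rwa [shiftSubst_coe, ← shiftSubst_update] at this
  refine ⟨Quotient E, f, ⟨fun x y => ?_, hfmul, hfneg, hfzero, ?_, fun i x => ?_, fun i j => ?_⟩,
    ?_, fun j => ?_⟩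
  · have hxy : A.add x y = A.neg (A.mul (A.neg x) (A.neg y)) := by
      change x ⊔ y = (xᶜ ⊓ yᶜ)ᶜ
      simp
    rw [hxy, hfneg, hfmul, hfneg, hfneg, ← Set.compl_union, compl_compl]
    rfl
  · have h1 : A.one = A.neg A.zero := by
      change (⊤ : A.carrier) = ⊥ᶜ
      simp
    rw [h1, hfneg, hfzero, Set.compl_empty]
    rfl
  · refine Set.ext fun s => ?_
    change S (fun i => (s i).out) (A.c i x) ∈ F ↔
      ∃ t : Fin n → Quotient E, S (fun i => (t i).out) x ∈ F ∧ ∀ j, j ≠ i → t j = s j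
    constructor
    · intro hs
      simp only [S, hcyl] at hs
      obtain ⟨m, hm⟩ := hwit _ i x hs
      refine ⟨Function.update s i ⟦m⟧, ?_, fun j hj => Function.update_of_ne hj _ _⟩
      have hout : (fun j => (Function.update s i (⟦m⟧ : Quotient E) j).out) =
          Function.update (Function.update (fun j => (s j).out) i m) i
            (⟦m⟧ : Quotient E).out := by
        ext j
        rcases eq_or_ne j i with rfl | hj
        · simp
        · simp [hj]
      rw [hout]
      refine hSdiag _ i _ x ?_ hm
      rw [Function.update_self]
      exact E.symm (Quotient.mk_out m)
    · rintro ⟨t, ht, hts⟩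
      have hout : (fun j => (t j).out) =
          Function.update (fun j => (s j).out) i (t i).out := by
        ext j
        rcases eq_or_ne j i with rfl | hj
        · simp
        · simp [hj, hts j hj]
      rw [hout] at ht
      refine hup _ ht _ ?_
      simp only [S, hcyl]
      rw [shiftSubst_update]
      exact h.substs_update_le (le_shiftSubst n _) le_rfl i.2 (Nat.le_add_right _ _) _
  · refine Set.ext fun s => ?_
    change S (fun i => (s i).out) (A.d i j) ∈ F ↔ s i = s j
    simp only [S, hdiag]
    rw [h.substs_diag (le_shiftSubst n _) le_rfl, if_pos i.2, if_pos j.2, shiftSubst_coe,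
      shiftSubst_coe]
    exact Quotient.out_equiv_out (s := E)
  · refine Set.Nonempty.ne_empty ⟨fun i => ⟦τ₀ i⟧, ?_⟩
    have key : ∀ s : Finset (Fin n),
        S (s.piecewise (fun i => (⟦τ₀ i⟧ : Quotient E).out) τ₀) a ∈ F := fun s => by
      induction s using Finset.induction_on with
      | empty => rw [Finset.piecewise_empty]; exact hτ₀
      | insert i s hi ih =>
        rw [Finset.piecewise_insert]
        refine hSdiag _ i _ a ?_ ih
        rw [Finset.piecewise_eq_of_notMem _ _ _ hi]
        exact E.symm (Quotient.mk_out (τ₀ i))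
    have := key Finset.univ
    rwa [Finset.piecewise_univ] at this
  · refine Set.eq_empty_of_forall_notMem fun s hs => ?_
    obtain ⟨x, hx, hxF⟩ := homit j fun i => (s i).out
    exact hxF (Set.mem_iInter₂.1 hs x hx)
end

section
/- There exists a quasipolyadic equality algebra A of dimension ω such that the cylindric reduct ⟨A,+,·,−,0,1,c_i,d_ij⟩_{i,j<ω} of A is a representable CA_ω, but A itself is not representable as a QPEA_ω: A is not isomorphic to any subdirect product of quasipolyadic equality weak set algebras of dimension ω. -/
universe u v w

/-- An algebra of the similarity type of quasipolyadic equality algebras of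
dimension `ι`:  Boolean operations, cylindrifications `c i`, substitutions
`s i j` (corresponding to the replacement `[i|j]`), transpositions `p i j`
and diagonal constants `d i j`. -/
structure RawQPEA (ι : Type v) : Type (max (u + 1) v) where
  carrier : Type u
  add : carrier → carrier → carrier
  mul : carrier → carrier → carrier
  neg : carrier → carrier
  zero : carrier
  one : carrier
  c : ι → carrier → carrier
  s : ι → ι → carrier → carrier
  p : ι → ι → carrier → carrier
  d : ι → ι → carrier

namespace RawQPEA

variable {ι : Type v}

/-- The Boolean order. -/
def le (M : RawQPEA.{u, v} ι) (x y : M.carrier) : Prop := M.add x y = y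

/-- The cylindric reduct `⟨A, +, ·, −, 0, 1, c_i, d_ij⟩` of `M`. -/
def toCA (M : RawQPEA.{u, v} ι) : RawCA.{u, v} ι :=
  ⟨M.carrier, M.add, M.mul, M.neg, M.zero, M.one, M.c, M.d⟩

/-- `M` is a quasipolyadic equality algebra of dimension `ι`. -/
def IsQPEA (M : RawQPEA.{u, v} ι) : Prop :=
  M.toCA.IsBoolean ∧
  (∀ i x, M.s i i x = x) ∧
  (∀ i x, M.p i i x = x) ∧
  (∀ i j x, M.p i j x = M.p j i x) ∧
  (∀ i x, M.le x (M.c i x)) ∧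
  (∀ i x y, M.c i (M.add x y) = M.add (M.c i x) (M.c i y)) ∧
  (∀ i j x, M.s i j (M.c i x) = M.c i x) ∧
  (∀ i j x, i ≠ j → M.c i (M.s i j x) = M.s i j x) ∧
  (∀ i j k x, k ≠ i → k ≠ j → M.s i j (M.c k x) = M.c k (M.s i j x)) ∧
  (∀ i j x y, M.s i j (M.add x y) = M.add (M.s i j x) (M.s i j y)) ∧
  (∀ i j x, M.s i j (M.neg x) = M.neg (M.s i j x)) ∧
  (∀ i j x y, M.p i j (M.add x y) = M.add (M.p i j x) (M.p i j y)) ∧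
  (∀ i j x, M.p i j (M.neg x) = M.neg (M.p i j x)) ∧
  (∀ i j x, M.p i j (M.p i j x) = x) ∧
  (∀ i j k x, i ≠ j → i ≠ k → j ≠ k → M.p i j (M.p i k x) = M.p j k (M.p i j x)) ∧
  (∀ i j x, M.p i j (M.s j i x) = M.s i j x) ∧
  (∀ i j, M.s i j (M.d i j) = M.one) ∧
  (∀ i j x, M.le (M.mul x (M.d i j)) (M.s i j x))

/-- Homomorphisms of the similarity type of quasipolyadic equality algebras. -/
def IsHom (M : RawQPEA.{u, v} ι) (N : RawQPEA.{w, v} ι) (f : M.carrier → N.carrier) : Prop :=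
  (∀ x y, f (M.add x y) = N.add (f x) (f y)) ∧
  (∀ x y, f (M.mul x y) = N.mul (f x) (f y)) ∧
  (∀ x, f (M.neg x) = N.neg (f x)) ∧
  f M.zero = N.zero ∧
  f M.one = N.one ∧
  (∀ i x, f (M.c i x) = N.c i (f x)) ∧
  (∀ i j x, f (M.s i j x) = N.s i j (f x)) ∧
  (∀ i j x, f (M.p i j x) = N.p i j (f x)) ∧
  (∀ i j, f (M.d i j) = N.d i j)

end RawQPEA

/-- The weak space `^ωU^(pt)` of all ω-sequences from `U` that differ from
the fixed sequence `pt` in at most finitely many places. -/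
def weakSpace (U : Type u) (pt : ℕ → U) : Set (ℕ → U) :=
  {σ | {k | σ k ≠ pt k}.Finite}

/-- The full quasipolyadic equality weak set algebra of dimension ω with unit
the weak space `^ωU^(pt)`:  Boolean set operations relativized to the weak
space, cylindrifications `C_i`, substitutions `S_i^j X = {s : s∘[i|j] ∈ X}`,
transpositions `P_ij X = {s : s∘[i,j] ∈ X}` and diagonals `D_ij`.
(A quasipolyadic equality weak set algebra is a subalgebra of such an
algebra.) -/
def weakAlg (U : Type u) (pt : ℕ → U) : RawQPEA.{u, 0} ℕ where
  carrier := Set (ℕ → U)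
  add X Y := X ∪ Y
  mul X Y := X ∩ Y
  neg X := weakSpace U pt \ X
  zero := ∅
  one := weakSpace U pt
  c i X := weakSpace U pt ∩ {σ | ∃ t ∈ X, ∀ j, j ≠ i → t j = σ j}
  s i j X := weakSpace U pt ∩ {σ | (fun k => if k = i then σ j else σ k) ∈ X}
  p i j X := weakSpace U pt ∩ {σ | (fun k => σ (Equiv.swap i j k)) ∈ X}
  d i j := weakSpace U pt ∩ {σ | σ i = σ j}

/-- The direct product of a family of algebras of the quasipolyadic equality
similarity type. -/
def prodQPEA {ι : Type v} {I : Type w} (F : I → RawQPEA.{u, v} ι) :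
    RawQPEA.{max u w, v} ι where
  carrier := ∀ i, (F i).carrier
  add f g := fun i => (F i).add (f i) (g i)
  mul f g := fun i => (F i).mul (f i) (g i)
  neg f := fun i => (F i).neg (f i)
  zero := fun i => (F i).zero
  one := fun i => (F i).one
  c j f := fun i => (F i).c j (f i)
  s j k f := fun i => (F i).s j k (f i)
  p j k f := fun i => (F i).p j k (f i)
  d j k := fun i => (F i).d j k

/-- `M` is a representable `QPEA_ω`:  `M` is isomorphic to a subdirect
product of quasipolyadic equality weak set algebras of dimension ω. -/
def RepresentableQPEA (M : RawQPEA.{0, 0} ℕ) : Prop :=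
  ∃ (I : Type) (U : I → Type) (pt : ∀ i, ℕ → U i)
    (f : M.carrier → (prodQPEA fun i => weakAlg (U i) (pt i)).carrier),
    Function.Injective f ∧ RawQPEA.IsHom M (prodQPEA fun i => weakAlg (U i) (pt i)) f

namespace TwistedQPEA

/-- Sequences of natural numbers that differ from `n ↦ n + 2` in finitely many places. -/
abbrev ShiftSeq : Type := {z : ℕ → ℕ // ∃ N, ∀ n ≥ N, z n = n + 2}

namespace ShiftSeq

/-- The sequence `z` with its `i`-th entry replaced by `a`. -/
def upd (z : ShiftSeq) (i a : ℕ) : ShiftSeq :=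
  ⟨Function.update z.1 i a, by
    obtain ⟨N, hN⟩ := z.2
    refine ⟨N + i + 1, fun n hn => ?_⟩
    rw [Function.update_of_ne (by omega)]
    exact hN n (by omega)⟩

/-- The sequence `z` with its `i`-th and `j`-th entries interchanged. -/
def swp (z : ShiftSeq) (i j : ℕ) : ShiftSeq := (z.upd i (z.1 j)).upd j (z.1 i)

/-- The transposition of the values `a` and `b` applied to all entries of `z`. -/
def act (a b : ℕ) (z : ShiftSeq) : ShiftSeq :=
  ⟨fun n => Equiv.swap a b (z.1 n), by
    obtain ⟨N, hN⟩ := z.2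
    refine ⟨N + a + b + 1, fun n hn => ?_⟩
    change Equiv.swap a b (z.1 n) = n + 2
    rw [hN n (by omega), Equiv.swap_apply_of_ne_of_ne (by omega) (by omega)]⟩

theorem upd_apply (z : ShiftSeq) (i a n : ℕ) : (z.upd i a).1 n = if n = i then a else z.1 n := by
  simp [upd, Function.update_apply]

theorem act_apply (a b : ℕ) (z : ShiftSeq) (n : ℕ) : (act a b z).1 n = Equiv.swap a b (z.1 n) := rfl

theorem swp_apply (z : ShiftSeq) (i j n : ℕ) : (z.swp i j).1 n = z.1 (Equiv.swap i j n) := by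
  simp only [swp, upd_apply, Equiv.swap_apply_def]
  split_ifs <;> simp_all

theorem act_act (a b : ℕ) (z : ShiftSeq) : act a b (act a b z) = z :=
  Subtype.ext (funext fun n => by simp [act_apply])

theorem act_upd (a b : ℕ) (z : ShiftSeq) (i x : ℕ) :
    act a b (z.upd i x) = (act a b z).upd i (Equiv.swap a b x) :=
  Subtype.ext (funext fun n => by simp only [act_apply, upd_apply]; split_ifs <;> rfl)

theorem act_swp (a b : ℕ) (z : ShiftSeq) (i j : ℕ) :
    act a b (z.swp i j) = (act a b z).swp i j :=
  Subtype.ext (funext fun n => by simp only [act_apply, swp_apply])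

theorem swp_swp (z : ShiftSeq) (i j : ℕ) : (z.swp i j).swp i j = z :=
  Subtype.ext (funext fun n => by simp [swp_apply])

theorem upd_self (z : ShiftSeq) (i : ℕ) : z.upd i (z.1 i) = z :=
  Subtype.ext (funext fun n => by simp only [upd_apply]; split_ifs <;> simp_all)

end ShiftSeq

open ShiftSeq

/-- `a` and `b` are distinct values that both lie in `{0, 1, 2}` or both lie outside of it. -/
def Good (a b : ℕ) : Prop := a ≠ b ∧ (a < 3 ↔ b < 3)

theorem good_zero_one : Good 0 1 := ⟨by omega, by omega⟩

/-- Every sequence is fixed off any given coordinate by some good transposition. -/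
theorem exists_good_fixing (z : ShiftSeq) (k : ℕ) :
    ∃ a b, Good a b ∧ ∀ n, n ≠ k → (act a b z).1 n = z.1 n := by
  obtain ⟨N, hN⟩ := z.2
  let M := N + k + 1
  let T : Finset ℕ := ((Finset.range M).erase k).image z.1
  have hT : T.card ≤ M - 1 := by
    refine Finset.card_image_le.trans ?_
    rw [Finset.card_erase_of_mem (by simp [M])]
    simp
  have hcard : 3 ≤ (Finset.range (M + 2) \ T).card := by
    have := Finset.le_card_sdiff T (Finset.range (M + 2))
    simp only [Finset.card_range] at this
    omega
  obtain ⟨a, ha, b, hb, hab, h⟩ :=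
    Finset.exists_ne_map_eq_of_card_lt_of_maps_to (s := Finset.range (M + 2) \ T)
      (t := (Finset.univ : Finset Bool)) (f := fun n => decide (n < 3))
      (by simp; omega) (fun _ _ => Finset.mem_coe.2 (Finset.mem_univ _))
  simp only [Finset.mem_sdiff, Finset.mem_range] at ha hb
  refine ⟨a, b, ⟨hab, by simpa using h⟩, fun n hn => ?_⟩
  have key : ∀ x, x < M + 2 ∧ x ∉ T → z.1 n ≠ x := by
    rintro x ⟨hx, hxT⟩ rfl
    rcases lt_or_ge n M with h' | h'
    · exact hxT (Finset.mem_image.2 ⟨n, by simp [hn, h'], rfl⟩)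
    · rw [hN n (by omega)] at hx
      omega
  rw [act_apply, Equiv.swap_apply_of_ne_of_ne (key a ha) (key b hb)]

/-- A set of sequences is even-invariant if it is closed under products of two good
transpositions of the values. -/
def EvenInvariant (Z : Set ShiftSeq) : Prop :=
  ∀ a b c d, Good a b → Good c d → ∀ z ∈ Z, act a b (act c d z) ∈ Z

theorem EvenInvariant.mem_iff {Z : Set ShiftSeq} (hZ : EvenInvariant Z) {a b c d : ℕ}
    (h : Good a b) (h' : Good c d) (z : ShiftSeq) : act a b (act c d z) ∈ Z ↔ z ∈ Z := by
  refine ⟨fun hz => ?_, hZ a b c d h h' z⟩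
  have := hZ c d a b h' h _ hz
  rwa [act_act, act_act] at this

/-- An even-invariant set cannot separate a sequence having a repeated entry from its image
under a good transposition. -/
theorem EvenInvariant.act_mem_iff {Z : Set ShiftSeq} (hZ : EvenInvariant Z) {a b : ℕ}
    (h : Good a b) {z : ShiftSeq} {i j : ℕ} (hij : i ≠ j) (hz : z.1 i = z.1 j) :
    act a b z ∈ Z ↔ z ∈ Z := by
  obtain ⟨c, d, hcd, hfix⟩ := exists_good_fixing z i
  have : act c d z = z := by
    refine Subtype.ext (funext fun n => ?_)
    rcases eq_or_ne n i with rfl | hn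
    · have := hfix j hij.symm
      rw [act_apply] at this ⊢
      rw [hz, this]
    · exact hfix n hn
  rw [← hZ.mem_iff h hcd z, this]

/-- The point map underlying the twisted transposition operation: besides interchanging two
entries, the values `0` and `1` are interchanged. -/
def twist (i j : ℕ) (z : ShiftSeq) : ShiftSeq := if i = j then z else act 0 1 (z.swp i j)

theorem twist_of_ne {i j : ℕ} (h : i ≠ j) (z : ShiftSeq) : twist i j z = act 0 1 (z.swp i j) := by
  simp [twist, h]

theorem twist_self (i : ℕ) (z : ShiftSeq) : twist i i z = z := by
  simp [twist]

theorem twist_twist (i j : ℕ) (z : ShiftSeq) : twist i j (twist i j z) = z := by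
  rcases eq_or_ne i j with rfl | h
  · simp [twist_self]
  · simp [twist_of_ne h, ← act_swp, act_act, swp_swp]

theorem twist_comm (i j : ℕ) (z : ShiftSeq) : twist i j z = twist j i z := by
  rcases eq_or_ne i j with rfl | h
  · rfl
  · rw [twist_of_ne h, twist_of_ne h.symm]
    congr 1
    exact Subtype.ext (funext fun n => by simp only [swp_apply, Equiv.swap_comm])

/-- The algebra of even-invariant sets of sequences, with the natural cylindric structure and
twisted transpositions. -/
def alg : RawQPEA.{0, 0} ℕ where
  carrier := {Z : Set ShiftSeq // EvenInvariant Z}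
  add X Y := ⟨X.1 ∪ Y.1, fun a b c d h h' z hz =>
    hz.imp (X.2 a b c d h h' z) (Y.2 a b c d h h' z)⟩
  mul X Y := ⟨X.1 ∩ Y.1, fun a b c d h h' z hz =>
    hz.imp (X.2 a b c d h h' z) (Y.2 a b c d h h' z)⟩
  neg X := ⟨X.1ᶜ, fun _ _ _ _ h h' z hz hz' => hz ((X.2.mem_iff h h' z).1 hz')⟩
  zero := ⟨∅, fun _ _ _ _ _ _ _ hz => hz⟩
  one := ⟨Set.univ, fun _ _ _ _ _ _ _ hz => hz⟩
  c i X := ⟨{z | ∃ x, z.upd i x ∈ X.1}, fun a b c d h h' z ⟨x, hx⟩ =>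
    ⟨_, by have := X.2 a b c d h h' _ hx; rwa [act_upd, act_upd] at this⟩⟩
  s i j X := ⟨{z | z.upd i (z.1 j) ∈ X.1}, fun a b c d h h' z hz => by
    have := X.2 a b c d h h' _ hz
    rwa [act_upd, act_upd] at this⟩
  p i j X := ⟨{z | twist i j z ∈ X.1}, fun a b c d h h' z hz => by
    rcases eq_or_ne i j with rfl | hij
    · simp only [twist_self, Set.mem_ofPred_eq] at hz ⊢
      exact X.2 a b c d h h' z hz
    · simp only [twist_of_ne hij, Set.mem_ofPred_eq, ← act_swp] at hz ⊢
      have := X.2 0 1 a b good_zero_one h _ (X.2 c d 0 1 h' good_zero_one _ hz)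
      rwa [act_act] at this⟩
  d i j := ⟨{z | z.1 i = z.1 j}, fun a b c d _ _ z hz => by
    simpa [act_apply] using hz⟩

theorem alg_isQPEA : alg.IsQPEA := by
  refine ⟨⟨?_, ?_, ?_, ?_, ?_, ?_, ?_, ?_⟩, ?_, ?_, ?_, ?_, ?_, ?_, ?_, ?_, ?_, ?_, ?_, ?_, ?_, ?_,
    ?_, ?_, ?_⟩
  · exact fun x y => Subtype.ext (Set.union_comm _ _)
  · exact fun x y => Subtype.ext (Set.inter_comm _ _)
  · exact fun x y z => Subtype.ext (Set.union_inter_distrib_left _ _ _)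
  · exact fun x y z => Subtype.ext (Set.inter_union_distrib_left _ _ _)
  · exact fun x => Subtype.ext (Set.union_empty _)
  · exact fun x => Subtype.ext (Set.inter_univ _)
  · exact fun x => Subtype.ext (Set.union_compl_self _)
  · exact fun x => Subtype.ext (Set.inter_compl_self _)
  · refine fun i x => Subtype.ext (Set.ext fun z => ?_)
    simp [alg, upd_self]
  · refine fun i x => Subtype.ext (Set.ext fun z => ?_)
    simp [alg, twist_self]
  · refine fun i j x => Subtype.ext (Set.ext fun z => ?_)
    simp [alg, twist_comm i j]
  · refine fun i x => Subtype.ext (Set.union_eq_self_of_subset_left fun z hz => ⟨z.1 i, ?_⟩)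
    rwa [upd_self]
  · refine fun i x y => Subtype.ext (Set.ext fun z => ?_)
    simp [alg, exists_or]
  · refine fun i j x => Subtype.ext (Set.ext fun z => ?_)
    simp [alg, upd]
  · refine fun i j x hij => Subtype.ext (Set.ext fun z => ?_)
    have (a : ℕ) : (z.upd i a).upd i ((z.upd i a).1 j) = z.upd i (z.1 j) :=
      Subtype.ext (by simp [upd, hij.symm])
    simp [alg, this]
  · refine fun i j k x hki hkj => Subtype.ext (Set.ext fun z => ?_)
    simp [alg, upd, hkj.symm, Function.update_comm hki]
  · exact fun i j x y => rfl
  · exact fun i j x => rfl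
  · exact fun i j x y => rfl
  · exact fun i j x => rfl
  · refine fun i j x => Subtype.ext (Set.ext fun z => ?_)
    simp [alg, twist_twist]
  · refine fun i j k x hij hik hjk => Subtype.ext (Set.ext fun z => ?_)
    have : twist i k (twist i j z) = twist i j (twist j k z) := by
      simp only [twist_of_ne hij, twist_of_ne hik, twist_of_ne hjk, ← act_swp]
      congr 2
      refine Subtype.ext (funext fun n => ?_)
      simp only [swp_apply, Equiv.swap_apply_def]
      split_ifs <;> simp_all
    simp [alg, this]
  · refine fun i j x => Subtype.ext (Set.ext fun z => ?_)
    rcases eq_or_ne i j with rfl | hij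
    · simp [alg, twist_self]
    · have : (twist i j z).upd j ((twist i j z).1 i) = act 0 1 (z.upd i (z.1 j)) := by
        rw [twist_of_ne hij]
        refine Subtype.ext (funext fun n => ?_)
        simp only [upd_apply, act_apply, swp_apply, Equiv.swap_apply_left, ← apply_ite]
        congr 1
        rw [Equiv.swap_apply_def]
        split_ifs <;> simp_all
      simp only [alg, Set.mem_ofPred_eq, this]
      exact x.2.act_mem_iff good_zero_one hij (by simp [upd_apply])
  · refine fun i j => Subtype.ext (Set.ext fun z => ?_)
    simp [alg, upd_apply]
  · refine fun i j x => Subtype.ext (Set.union_eq_self_of_subset_left fun z hz => ?_)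
    have h : z.1 i = z.1 j := hz.2
    simp only [alg, Set.mem_ofPred_eq, ← h, upd_self]
    exact hz.1

section Representability

open Filter

/-- Representatives for the elements of the ultrapower of `ℕ`, constants being represented by
constant sequences. -/
theorem exists_representatives :
    ∃ r : Germ (hyperfilter ℕ : Filter ℕ) ℕ → ℕ → ℕ,
      (∀ q, ((r q : ℕ → ℕ) : Germ (hyperfilter ℕ : Filter ℕ) ℕ) = q) ∧
      ∀ a : ℕ, r ((fun _ => a : ℕ → ℕ) : Germ (hyperfilter ℕ : Filter ℕ) ℕ) = fun _ => a := by
  classical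
  have h : ∀ q : Germ (hyperfilter ℕ : Filter ℕ) ℕ, ∃ f : ℕ → ℕ,
      (f : Germ (hyperfilter ℕ : Filter ℕ) ℕ) = q ∧
      ∀ a : ℕ, q = ((fun _ => a : ℕ → ℕ) : Germ (hyperfilter ℕ : Filter ℕ) ℕ) →
        f = fun _ => a := by
    intro q
    by_cases hq : ∃ a : ℕ, q = ((fun _ => a : ℕ → ℕ) : Germ (hyperfilter ℕ : Filter ℕ) ℕ)
    · obtain ⟨a, rfl⟩ := hq
      refine ⟨fun _ => a, rfl, fun b hb => ?_⟩
      obtain ⟨n, hn⟩ := (Germ.coe_eq.1 hb).exists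
      exact funext fun _ => hn
    · obtain ⟨f, rfl⟩ := Quotient.exists_rep q
      exact ⟨f, rfl, fun a ha => (hq ⟨a, ha⟩).elim⟩
  choose r h1 h2 using h
  exact ⟨r, h1, fun a => h2 _ a rfl⟩

/-- The sequence that follows `f` below `n` and is `k ↦ k + 2` from `n` on. -/
def trunc (n : ℕ) (f : ℕ → ℕ) : ShiftSeq :=
  ⟨fun k => if k < n then f k else k + 2, n, fun k hk => if_neg (by omega)⟩

theorem trunc_upd {n i : ℕ} (h : i < n) (f : ℕ → ℕ) (x : ℕ) :
    (trunc n f).upd i x = trunc n (Function.update f i x) := by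
  refine Subtype.ext (funext fun k => ?_)
  simp only [upd_apply, trunc, Function.update_apply]
  split_ifs <;> first | rfl | omega

theorem alg_toCA_representable : alg.toCA.Representable := by
  obtain ⟨r, hr, hconst⟩ := exists_representatives
  have hgt : ∀ i : ℕ, ∀ᶠ n in (hyperfilter ℕ : Filter ℕ), i < n := fun i =>
    (Nat.hyperfilter_le_atTop : _ ≤ _) (eventually_gt_atTop i)
  let tr : (ℕ → Germ (hyperfilter ℕ : Filter ℕ) ℕ) → ℕ → ShiftSeq :=
    fun q n => trunc n fun k => r (q k) n
  refine ⟨Unit, fun _ => Germ (hyperfilter ℕ : Filter ℕ) ℕ,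
    fun Z _ => {q | ∀ᶠ n in (hyperfilter ℕ : Filter ℕ), tr q n ∈ Z.1}, ?_, ?_⟩
  · have hmem : ∀ z : ShiftSeq, ∀ Z : Set ShiftSeq,
        (∀ᶠ n in (hyperfilter ℕ : Filter ℕ),
          tr (fun k => ((fun _ => z.1 k : ℕ → ℕ) : Germ (hyperfilter ℕ : Filter ℕ) ℕ)) n ∈ Z) ↔
        z ∈ Z := by
      intro z Z
      obtain ⟨N, hN⟩ := z.2
      have : ∀ᶠ n in (hyperfilter ℕ : Filter ℕ),
          tr (fun k => ((fun _ => z.1 k : ℕ → ℕ) : Germ (hyperfilter ℕ : Filter ℕ) ℕ)) n = z := by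
        filter_upwards [hgt N] with n hn
        refine Subtype.ext (funext fun k => ?_)
        simp only [tr, trunc, hconst]
        split_ifs with h
        · rfl
        · exact (hN k (by omega)).symm
      rw [eventually_congr (this.mono fun n hn => by rw [hn])]
      simp
    intro X Y hXY
    refine Subtype.ext (Set.ext fun z => ?_)
    rw [← hmem z X.1, ← hmem z Y.1]
    exact Set.ext_iff.1 (congrFun hXY ()) _
  · refine ⟨fun X Y => ?_, fun X Y => ?_, fun X => ?_, ?_, ?_, fun i X => ?_, fun i j => ?_⟩
    · exact funext fun _ => Set.ext fun q => Ultrafilter.eventually_or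
    · exact funext fun _ => Set.ext fun q => eventually_and
    · exact funext fun _ => Set.ext fun q => Ultrafilter.eventually_not
    · refine funext fun _ => Set.ext fun q => ?_
      simp [alg, RawQPEA.toCA, prodAlg, fullSetAlg, Ultrafilter.neBot _ |>.ne]
    · refine funext fun _ => Set.ext fun q => ?_
      simp [alg, RawQPEA.toCA, prodAlg, fullSetAlg]
    · refine funext fun _ => Set.ext fun q => ?_
      change (∀ᶠ n in (hyperfilter ℕ : Filter ℕ), ∃ x, (tr q n).upd i x ∈ X.1) ↔
        ∃ t, (∀ᶠ n in (hyperfilter ℕ : Filter ℕ), tr t n ∈ X.1) ∧ ∀ j, j ≠ i → t j = q j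
      constructor
      · intro h
        obtain ⟨x, hx⟩ := h.choice
        refine ⟨Function.update q i (x : Germ (hyperfilter ℕ : Filter ℕ) ℕ), ?_,
          fun j hj => Function.update_of_ne hj _ _⟩
        filter_upwards [hx, hgt i,
          Germ.coe_eq.1 (hr (x : Germ (hyperfilter ℕ : Filter ℕ) ℕ))] with n h1 h2 h3
        rw [trunc_upd h2] at h1
        convert h1 using 2
        refine funext fun k => ?_
        rcases eq_or_ne k i with rfl | hk
        · simpa using h3
        · simp [hk]
      · rintro ⟨t, ht, htq⟩
        filter_upwards [ht, hgt i] with n h1 h2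
        refine ⟨r (t i) n, ?_⟩
        rw [trunc_upd h2]
        convert h1 using 2
        refine funext fun k => ?_
        rcases eq_or_ne k i with rfl | hk
        · simp
        · simp [hk, htq k hk]
    · refine funext fun _ => Set.ext fun q => ?_
      change (∀ᶠ n in (hyperfilter ℕ : Filter ℕ), (tr q n).1 i = (tr q n).1 j) ↔ q i = q j
      have : ∀ᶠ n in (hyperfilter ℕ : Filter ℕ),
          ((tr q n).1 i = (tr q n).1 j ↔ r (q i) n = r (q j) n) := by
        filter_upwards [hgt i, hgt j] with n h1 h2
        simp [tr, trunc, h1, h2]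
      rw [eventually_congr this]
      conv_rhs => rw [← hr (q i), ← hr (q j)]
      exact Germ.coe_eq.symm

end Representability

/-- The permutation of the values that is the product of a list of transpositions. -/
def listPerm (L : List (ℕ × ℕ)) : Equiv.Perm ℕ := (L.map fun q => Equiv.swap q.1 q.2).prod

theorem listPerm_ne_one_of_odd (L : List (ℕ × ℕ)) (hL : ∀ q ∈ L, q.1 ≠ q.2)
    (hodd : Odd L.length) : listPerm L ≠ 1 := by
  have hbound : ∃ N, ∀ q ∈ L, q.1 ∈ Finset.range N ∧ q.2 ∈ Finset.range N := by
    clear hL hodd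
    induction L with
    | nil => simp
    | cons q L ih =>
      obtain ⟨N, hN⟩ := ih
      refine ⟨N + q.1 + q.2 + 1, fun q' hq' => ?_⟩
      simp only [Finset.mem_range] at hN ⊢
      rcases List.mem_cons.1 hq' with rfl | hq'
      · omega
      · have := hN q' hq'
        omega
  obtain ⟨N, hN⟩ := hbound
  have hlift : ∃ e : Equiv.Perm {n // n ∈ Finset.range N},
      Equiv.Perm.ofSubtype e = listPerm L ∧ Equiv.Perm.sign e = (-1) ^ L.length := by
    clear hodd
    induction L with
    | nil => exact ⟨1, by simp [listPerm], by simp⟩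
    | cons q L ih =>
      obtain ⟨e, he, hsign⟩ := ih (fun q' h => hL q' (by simp [h])) fun q' h => hN q' (by simp [h])
      have hq := hN q (by simp)
      refine ⟨Equiv.swap ⟨q.1, hq.1⟩ ⟨q.2, hq.2⟩ * e, ?_, ?_⟩
      · rw [map_mul, he, Equiv.Perm.ofSubtype_swap_eq]
        simp [listPerm]
      · rw [map_mul, hsign, Equiv.Perm.sign_swap (by simpa using hL q (by simp)), List.length_cons,
          pow_succ']
  obtain ⟨e, he, hsign⟩ := hlift
  intro h
  rw [h] at he
  have : e = 1 := Equiv.Perm.ofSubtype_injective (by rw [he, map_one])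
  rw [this, map_one, hodd.neg_one_pow] at hsign
  exact absurd hsign (by decide)

theorem listPerm_lt_iff (L : List (ℕ × ℕ)) (hL : ∀ q ∈ L, Good q.1 q.2) (n : ℕ) :
    listPerm L n < 3 ↔ n < 3 := by
  induction L with
  | nil => simp [listPerm]
  | cons q L ih =>
    have ih := ih fun q hq => hL q (by simp [hq])
    have hq := (hL q (by simp)).2
    simp only [listPerm, List.map_cons, List.prod_cons, Equiv.Perm.mul_apply] at ih ⊢
    rw [← ih, Equiv.swap_apply_def]
    split_ifs with h1 h2
    · rw [h1]; exact hq.symm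
    · rw [h2]; exact hq
    · rfl

/-- An injective sequence that takes its first two values in `{0, 1, 2}` and the others outside,
and misses precisely the values `2` and `3`. -/
def base : ShiftSeq := ⟨fun n => if n < 2 then n else n + 2, 2, fun n hn => if_neg (by omega)⟩

/-- The orbit of `base` under products of `m` good transpositions, `m ≡ r` modulo two. -/
def orbit (r : ℕ) : Set ShiftSeq :=
  {z | ∃ L : List (ℕ × ℕ), (∀ q ∈ L, Good q.1 q.2) ∧ L.length % 2 = r % 2 ∧
    ∀ n, z.1 n = listPerm L (base.1 n)}

theorem base_mem_orbit : base ∈ orbit 0 := ⟨[], by simp, rfl, fun n => by simp [listPerm]⟩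

theorem act_mem_orbit {r : ℕ} {z : ShiftSeq} (hz : z ∈ orbit r) {a b : ℕ} (h : Good a b) :
    act a b z ∈ orbit (r + 1) := by
  obtain ⟨L, hL, hr, hz⟩ := hz
  refine ⟨(a, b) :: L, ?_, by simp; omega, fun n => ?_⟩
  · simpa [h] using hL
  · simp [act_apply, hz, listPerm]

theorem orbit_add_two (r : ℕ) : orbit (r + 2) = orbit r := by
  simp [orbit]

theorem orbit_evenInvariant (r : ℕ) : EvenInvariant (orbit r) := by
  intro a b c d h h' z hz
  rw [← orbit_add_two]
  exact act_mem_orbit (act_mem_orbit hz h') h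

theorem apply_one_lt_of_mem_orbit {r : ℕ} {z : ShiftSeq} (hz : z ∈ orbit r) : z.1 1 < 3 := by
  obtain ⟨L, hL, -, hz⟩ := hz
  rw [hz, listPerm_lt_iff L hL]
  simp [base]

theorem apply_zero_ne_of_mem_orbit {r : ℕ} {z : ShiftSeq} (hz : z ∈ orbit r) : z.1 0 ≠ z.1 1 := by
  obtain ⟨L, -, -, hz⟩ := hz
  rw [hz, hz]
  simp [base]

theorem disjoint_orbit : orbit 0 ∩ orbit 1 = ∅ := by
  refine Set.eq_empty_of_forall_notMem fun z hz => ?_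
  obtain ⟨⟨L, hL, hr, hz⟩, ⟨L', hL', hr', hz'⟩⟩ := hz
  have hrev : ∀ M : List (ℕ × ℕ), listPerm M.reverse = (listPerm M)⁻¹ := by
    intro M
    induction M with
    | nil => simp [listPerm]
    | cons q M ih => simp_all [listPerm]
  have hgood : ∀ q ∈ L'.reverse ++ L, Good q.1 q.2 := by
    intro q hq
    rw [List.mem_append, List.mem_reverse] at hq
    exact hq.elim (hL' q) (hL q)
  refine listPerm_ne_one_of_odd (L'.reverse ++ L) (fun q hq => (hgood q hq).1)
    (by rw [List.length_append, List.length_reverse, Nat.odd_iff]; omega) ?_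
  set π := listPerm (L'.reverse ++ L) with hπ
  have hlt := listPerm_lt_iff _ hgood
  rw [← hπ] at hlt
  have hfix : ∀ n, π (base.1 n) = base.1 n := by
    intro n
    have : π = (listPerm L')⁻¹ * listPerm L := by rw [← hrev, hπ]; simp [listPerm]
    rw [this, Equiv.Perm.mul_apply, Equiv.Perm.inv_eq_iff_eq, ← hz, ← hz']
  have h0 : π 0 = 0 := by simpa [base] using hfix 0
  have h1 : π 1 = 1 := by simpa [base] using hfix 1
  have hge : ∀ n, 4 ≤ n → π n = n := by
    intro n hn
    have := hfix (n - 2)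
    rwa [show base.1 (n - 2) = n by simp only [base]; split_ifs <;> omega] at this
  have h2 : π 2 = 2 := by
    have := (hlt 2).2 (by omega)
    have := π.injective.ne (show 2 ≠ 0 by omega)
    have := π.injective.ne (show 2 ≠ 1 by omega)
    omega
  have h3 : π 3 = 3 := by
    by_contra h
    have h' : ¬ π 3 < 3 := fun h => absurd ((hlt 3).1 h) (by omega)
    have := hge (π 3) (by omega)
    exact h (π.injective this)
  ext n
  rw [Equiv.Perm.one_apply]
  rcases lt_or_ge n 4 with hn | hn
  · interval_cases n <;> assumption
  · exact hge n hn

theorem twist_mem_orbit {r : ℕ} {z : ShiftSeq} (hz : z ∈ orbit r) : twist 0 1 z ∈ orbit r := by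
  obtain ⟨L, hL, hr, hz⟩ := hz
  rw [twist_of_ne (by omega), ← orbit_add_two]
  refine act_mem_orbit (r := r + 1) ⟨L ++ [(0, 1)], ?_, by simp; omega, fun n => ?_⟩ good_zero_one
  · intro q hq
    rw [List.mem_append, List.mem_singleton] at hq
    rcases hq with hq | rfl
    exacts [hL q hq, good_zero_one]
  · have : base.1 (Equiv.swap 0 1 n) = Equiv.swap 0 1 (base.1 n) := by
      simp only [base, Equiv.swap_apply_def]
      split_ifs <;> simp_all
    simp [swp_apply, hz, this, listPerm]

/-- The orbit of `base` under products of `r` (modulo two) good transpositions, as an element. -/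
def orb (r : ℕ) : alg.carrier := ⟨orbit r, orbit_evenInvariant r⟩

/-- The set of sequences whose entry at `1` lies in `{0, 1, 2}`, as an element. -/
def small : alg.carrier := ⟨{z | z.1 1 < 3}, fun a b c d h h' z hz => by
  have key : ∀ a b, Good a b → ∀ z : ShiftSeq, z.1 1 < 3 → (act a b z).1 1 < 3 := by
    intro a b h z hz
    have := h.2
    rw [act_apply, Equiv.swap_apply_def]
    split_ifs <;> omega
  exact key a b h _ (key c d h' z hz)⟩

theorem orb_ne_zero : orb 0 ≠ alg.zero := fun h =>
  (Set.ext_iff.1 (congrArg Subtype.val h) base).1 base_mem_orbit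

theorem mul_orb : alg.mul (orb 0) (orb 1) = alg.zero := Subtype.ext disjoint_orbit

theorem c_orb : alg.c 1 (orb 0) = alg.c 1 (orb 1) := by
  have key : ∀ r z, z ∈ (alg.c 1 (orb r)).1 → z ∈ (alg.c 1 (orb (r + 1))).1 := by
    rintro r z ⟨x, hx⟩
    obtain ⟨a, b, h, hfix⟩ := exists_good_fixing (z.upd 1 x) 1
    refine ⟨Equiv.swap a b x, ?_⟩
    have hmem : act a b (z.upd 1 x) ∈ (orb (r + 1)).1 := act_mem_orbit hx h
    convert hmem using 1
    refine Subtype.ext (funext fun n => ?_)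
    rcases eq_or_ne n 1 with rfl | hn
    · simp [act_apply, upd_apply]
    · rw [hfix n hn]
      simp [upd_apply, hn]
  refine Subtype.ext (Set.ext fun z => ⟨key 0 z, fun hz => ?_⟩)
  have := key 1 z hz
  have h : orb 2 = orb 0 := Subtype.ext (orbit_add_two 0)
  rwa [show 1 + 1 = 2 from rfl, h] at this

theorem p_orb (r : ℕ) : alg.p 0 1 (orb r) = orb r := by
  refine Subtype.ext (Set.ext fun z => ⟨fun hz => ?_, fun hz => twist_mem_orbit hz⟩)
  rw [← twist_twist 0 1 z]
  exact twist_mem_orbit hz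

theorem orb_mul_d (r : ℕ) : alg.mul (orb r) (alg.d 0 1) = alg.zero :=
  Subtype.ext (Set.eq_empty_of_forall_notMem fun _ hz => apply_zero_ne_of_mem_orbit hz.1 hz.2)

theorem orb_le_small (r : ℕ) : alg.add (orb r) small = small :=
  Subtype.ext (Set.union_eq_self_of_subset_left fun _ hz => apply_one_lt_of_mem_orbit hz)

theorem c_small {k : ℕ} (hk : k ≠ 1) : alg.c k small = small := by
  refine Subtype.ext (Set.ext fun z => ?_)
  simp [alg, small, upd_apply, hk.symm]

/-- Four entries that all lie in `{0, 1, 2}` are not pairwise distinct. -/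
theorem small_pigeonhole :
    alg.mul (alg.mul (alg.mul (alg.s 1 0 small) small) (alg.mul (alg.s 1 2 small) (alg.s 1 3 small)))
      (alg.neg (alg.add (alg.add (alg.add (alg.d 0 1) (alg.d 0 2)) (alg.add (alg.d 0 3) (alg.d 1 2)))
        (alg.add (alg.d 1 3) (alg.d 2 3)))) = alg.zero := by
  refine Subtype.ext (Set.eq_empty_of_forall_notMem fun z hz => ?_)
  simp only [alg, small, upd_apply, Set.mem_inter_iff, Set.mem_ofPred_eq, Set.mem_compl_iff,
    Set.mem_union, if_true] at hz
  omega

theorem update_mem_weakSpace {U : Type*} {pt σ : ℕ → U} (h : σ ∈ weakSpace U pt) (i : ℕ) (x : U) :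
    Function.update σ i x ∈ weakSpace U pt := by
  refine (Set.Finite.insert i h).subset fun k hk => ?_
  rcases eq_or_ne k i with rfl | hki
  · exact Set.mem_insert _ _
  · exact Set.mem_insert_of_mem _ (by simpa [hki] using hk)

/-- Every homomorphism into a weak set algebra annihilates the orbit of `base`. -/
theorem map_orb_eq_empty {U : Type} {pt : ℕ → U} {F : alg.carrier → Set (ℕ → U)}
    (hF : RawQPEA.IsHom alg (weakAlg U pt) F) : F (orb 0) = ∅ := by
  obtain ⟨hadd, hmul, hneg, hzero, hone, hc, hs, hp, hd⟩ := hF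
  simp only [weakAlg] at hadd hmul hneg hzero hone hc hs hp hd
  have hV : ∀ X, F X ⊆ weakSpace U pt := by
    intro X
    rw [← hone, ← show alg.add X (alg.neg X) = alg.one from alg_isQPEA.1.2.2.2.2.2.2.1 X, hadd]
    exact Set.subset_union_left
  have hdisj : ∀ σ, σ ∈ F (orb 0) → σ ∉ F (orb 1) := by
    intro σ h h'
    have : σ ∈ F (alg.mul (orb 0) (orb 1)) := by rw [hmul]; exact ⟨h, h'⟩
    rwa [mul_orb, hzero] at this
  have hne : ∀ r σ, σ ∈ F (orb r) → σ 0 ≠ σ 1 := by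
    intro r σ h h'
    have : σ ∈ F (alg.mul (orb r) (alg.d 0 1)) := by rw [hmul, hd]; exact ⟨h, hV _ h, h'⟩
    rwa [orb_mul_d, hzero] at this
  have hsmall : ∀ r σ, σ ∈ F (orb r) → σ ∈ F small := by
    intro r σ h
    rw [← orb_le_small r, hadd]
    exact Or.inl h
  have hupd : ∀ σ ∈ F small, ∀ k ≠ 1, ∀ x, Function.update σ k x ∈ F small := by
    intro σ h k hk x
    rw [← c_small hk, hc]
    exact ⟨update_mem_weakSpace (hV _ h) k x, σ, h, fun j hj => by simp [hj]⟩
  have hc_iff : ∀ i X σ, σ ∈ F (alg.c i X) ↔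
      σ ∈ weakSpace U pt ∧ ∃ x, Function.update σ i x ∈ F X := by
    intro i X σ
    rw [hc]
    refine and_congr_right fun _ => ⟨?_, ?_⟩
    · rintro ⟨t, ht, h⟩
      refine ⟨t i, ?_⟩
      convert ht
      refine funext fun j => ?_
      rcases eq_or_ne j i with rfl | hj
      · simp
      · simp [hj, h j hj]
    · rintro ⟨x, hx⟩
      exact ⟨_, hx, fun j hj => by simp [hj]⟩
  refine Set.eq_empty_of_forall_notMem fun σ hσ => ?_
  have hσV := hV _ hσ
  let pr : U → U → ℕ → U := fun x y => Function.update (Function.update σ 0 x) 1 y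
  have hpr : pr (σ 0) (σ 1) = σ := by simp [pr]
  have hprV : ∀ x y, pr x y ∈ weakSpace U pt := fun x y =>
    update_mem_weakSpace (update_mem_weakSpace hσV 0 x) 1 y
  have hswap : ∀ r x y, pr x y ∈ F (orb r) → pr y x ∈ F (orb r) := by
    intro r x y h
    rw [← p_orb, hp]
    refine ⟨hprV y x, ?_⟩
    rw [Set.mem_ofPred_eq]
    convert h using 1
    refine funext fun k => ?_
    simp only [pr, Function.update_apply, Equiv.swap_apply_def]
    split_ifs <;> simp_all
  have hnext : ∀ x y, pr x y ∈ F (alg.c 1 (orb 0)) → ∀ r, r = 0 ∨ r = 1 →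
      ∃ w, pr x w ∈ F (orb r) := by
    rintro x y h r hr
    have h' : pr x y ∈ F (alg.c 1 (orb r)) := by
      rcases hr with rfl | rfl
      exacts [h, c_orb ▸ h]
    obtain ⟨-, w, hw⟩ := (hc_iff _ _ _).1 h'
    exact ⟨w, by simpa [pr] using hw⟩
  have hle : ∀ r, r = 0 ∨ r = 1 → ∀ x y, pr x y ∈ F (orb r) → pr x y ∈ F (alg.c 1 (orb 0)) := by
    rintro r hr x y h
    have h' : pr x y ∈ F (alg.c 1 (orb r)) :=
      (hc_iff _ _ _).2 ⟨hprV x y, y, by simpa [pr] using h⟩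
    rcases hr with rfl | rfl
    exacts [h', c_orb ▸ h']
  have hprne : ∀ r x y, pr x y ∈ F (orb r) → x ≠ y := fun r x y h => by
    simpa [pr] using hne r _ h
  have hlast : ∀ r x y, pr x y ∈ F (orb r) → Function.update σ 1 y ∈ F small := by
    intro r x y h
    have := hupd _ (hsmall r _ h) 0 (by omega) (σ 0)
    rw [Function.update_comm (by omega)] at this
    simpa [pr] using this
  have hfour : ∀ a b c x, Function.update σ 1 a ∈ F small → Function.update σ 1 b ∈ F small →
      Function.update σ 1 c ∈ F small → Function.update σ 1 x ∈ F small →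
      a ≠ b → a ≠ c → b ≠ c → a ≠ x → b ≠ x → c = x := by
    intro a b c x ha hb hc' hx hab hac hbc hax hbx
    by_contra hcx
    let τ : ℕ → U := Function.update (Function.update (Function.update (Function.update σ 0 a) 1 b)
      2 c) 3 x
    have hτV : τ ∈ weakSpace U pt := update_mem_weakSpace (update_mem_weakSpace
      (update_mem_weakSpace (update_mem_weakSpace hσV _ _) _ _) _ _) _ _
    have hτ : ∀ y, Function.update σ 1 y ∈ F small → Function.update τ 1 y ∈ F small := by
      intro y hy
      convert hupd _ (hupd _ (hupd _ hy 0 (by omega) a) 2 (by omega) c) 3 (by omega) x using 1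
      refine funext fun k => ?_
      simp only [τ, Function.update_apply]
      split_ifs <;> first | rfl | omega
    have hsub : ∀ j, Function.update σ 1 (τ j) ∈ F small → τ ∈ F (alg.s 1 j small) := by
      intro j hj
      rw [hs]
      refine ⟨hτV, ?_⟩
      rw [Set.mem_ofPred_eq]
      convert hτ _ hj using 1
      exact funext fun k => by simp [Function.update_apply]
    have h0 : τ 0 = a := by simp [τ]
    have h1 : τ 1 = b := by simp [τ]
    have h2 : τ 2 = c := by simp [τ]
    have h3 : τ 3 = x := by simp [τ]
    have hb' : τ ∈ F small := by
      have := hτ b hb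
      rwa [← h1, Function.update_eq_self] at this
    have := congrArg F small_pigeonhole
    simp only [hmul, hneg, hadd, hd, hzero] at this
    refine (Set.ext_iff.1 this τ).1 ⟨⟨⟨hsub 0 (h0 ▸ ha), hb'⟩, hsub 2 (h2 ▸ hc'), hsub 3 (h3 ▸ hx)⟩,
      hτV, ?_⟩
    simp [h0, h1, h2, h3, hab, hac, hbc, hax, hbx, hcx]
  set a := σ 0
  set b := σ 1
  have hab : pr a b ∈ F (orb 0) := by rwa [hpr]
  obtain ⟨c, hac⟩ := hnext a b (hle 0 (by simp) a b hab) 1 (by simp)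
  have hba := hswap 0 a b hab
  have hca := hswap 1 a c hac
  have hbc_ne : b ≠ c := by
    rintro h
    rw [← h] at hac
    exact hdisj _ hab hac
  have key : ∀ r u v, pr u v ∈ F (orb r) → v ≠ a → v ≠ b → v = c := fun r u v h h1 h2 =>
    (hfour a b c v (hlast _ _ _ hba) (hlast _ _ _ hab) (hlast _ _ _ hac) (hlast _ _ _ h)
      (hprne _ _ _ hab) (hprne _ _ _ hac) hbc_ne h1.symm h2.symm).symm
  obtain ⟨v, hbv⟩ := hnext b a (hle 0 (by simp) b a hba) 1 (by simp)
  have hv : v = c := by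
    refine key 1 b v hbv ?_ (hprne _ _ _ hbv).symm
    rintro rfl
    exact hdisj _ hba hbv
  rw [hv] at hbv
  have hcb := hswap 1 b c hbv
  obtain ⟨w, hcw⟩ := hnext c a (hle 1 (by simp) c a hca) 0 (by simp)
  refine hprne _ _ _ hcw (key 0 c w hcw ?_ ?_).symm
  · rintro rfl
    exact hdisj _ hcw hca
  · rintro rfl
    exact hdisj _ hcw hcb

theorem alg_not_representable : ¬ RepresentableQPEA alg := by
  rintro ⟨I, U, pt, f, hinj, hadd, hmul, hneg, hzero, hone, hc, hs, hp, hd⟩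
  refine orb_ne_zero (hinj (funext fun i => ?_))
  rw [hzero]
  exact map_orb_eq_empty (F := fun X => f X i)
    ⟨fun x y => congrFun (hadd x y) i, fun x y => congrFun (hmul x y) i,
      fun x => congrFun (hneg x) i, congrFun hzero i, congrFun hone i,
      fun j x => congrFun (hc j x) i, fun j k x => congrFun (hs j k x) i,
      fun j k x => congrFun (hp j k x) i, fun j k => congrFun (hd j k) i⟩

end TwistedQPEA

/-- There exists a quasipolyadic equality algebra `A` of dimension ω whose
cylindric reduct `⟨A, +, ·, −, 0, 1, c_i, d_ij⟩` is a representable `CA_ω`,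
but which is itself not representable as a `QPEA_ω`:  `A` is not isomorphic
to any subdirect product of quasipolyadic equality weak set algebras of
dimension ω. -/
theorem qpea_reduct_representable_but_not_qpea_representable :
    ∃ Q : RawQPEA.{0, 0} ℕ, Q.IsQPEA ∧ Q.toCA.Representable ∧ ¬ RepresentableQPEA Q :=
  ⟨TwistedQPEA.alg, TwistedQPEA.alg_isQPEA, TwistedQPEA.alg_toCA_representable,
    TwistedQPEA.alg_not_representable⟩
end

section
/- Let α be an infinite ordinal. Then: (i) there exist non-isomorphic representable CA_α's A and A′ and a single B∈CA_{α+ω} such that each of A and A′ is isomorphic to a subalgebra of Nr_α B that generates B; (ii) there exist A∈RCA_α, B∈CA_{α+ω} and an ideal J of B such that A⊆Nr_α B and A generates B, but Ig^B(J∩A)≠J; (iii) there exist A,A′∈RCA_α, B,B′∈CA_{α+ω}, embeddings e_A: A→Nr_α B and e_{A′}: A′→Nr_α B′ whose images generate B and B′ respectively, and an isomorphism i: A→A′ for which there is no isomorphism ī: B→B′ with ī∘e_A = e_{A′}∘i. -/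
universe u v w

/-- Membership in the subalgebra of `M` generated by the set `X`. -/
inductive InSubalg {ι : Type*} (M : RawCA ι) (X : Set M.carrier) : M.carrier → Prop
  | base {x} : x ∈ X → InSubalg M X x
  | zero : InSubalg M X M.zero
  | one : InSubalg M X M.one
  | add {x y} : InSubalg M X x → InSubalg M X y → InSubalg M X (M.add x y)
  | mul {x y} : InSubalg M X x → InSubalg M X y → InSubalg M X (M.mul x y)
  | neg {x} : InSubalg M X x → InSubalg M X (M.neg x)
  | cyl (i : ι) {x} : InSubalg M X x → InSubalg M X (M.c i x)
  | diag (i j : ι) : InSubalg M X (M.d i j)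

/-- The set `X` generates the algebra `M`. -/
def RawCA.Generates {ι : Type*} (M : RawCA ι) (X : Set M.carrier) : Prop :=
  ∀ b, InSubalg M X b

/-- An ideal of `M`:  contains `0`, closed under `+`, downward closed, and
closed under each cylindrification. -/
def RawCA.IsIdeal {ι : Type*} (M : RawCA ι) (I : Set M.carrier) : Prop :=
  M.zero ∈ I ∧
  (∀ x ∈ I, ∀ y ∈ I, M.add x y ∈ I) ∧
  (∀ x ∈ I, ∀ y, M.le y x → y ∈ I) ∧
  (∀ x ∈ I, ∀ i, M.c i x ∈ I)

/-- `Ig^M X`:  the least ideal of `M` containing `X`. -/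
def RawCA.IdealGen {ι : Type*} (M : RawCA ι) (X : Set M.carrier) : Set M.carrier :=
  {b | ∀ I : Set M.carrier, M.IsIdeal I → X ⊆ I → b ∈ I}

/-! ### Subalgebras, products and full set algebras -/

namespace RawCA

/-- The set `S` is closed under all operations of `M`. -/
structure IsSubuniverse {ι : Type v} (M : RawCA.{u, v} ι) (S : Set M.carrier) : Prop where
  add : ∀ x ∈ S, ∀ y ∈ S, M.add x y ∈ S
  mul : ∀ x ∈ S, ∀ y ∈ S, M.mul x y ∈ S
  neg : ∀ x ∈ S, M.neg x ∈ S
  zero : M.zero ∈ S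
  one : M.one ∈ S
  c : ∀ i, ∀ x ∈ S, M.c i x ∈ S
  d : ∀ i j, M.d i j ∈ S

/-- The subalgebra of `M` with universe `S`. -/
def subAlg {ι : Type v} (M : RawCA.{u, v} ι) (S : Set M.carrier) (h : M.IsSubuniverse S) :
    RawCA.{u, v} ι where
  carrier := S
  add x y := ⟨M.add x y, h.add _ x.2 _ y.2⟩
  mul x y := ⟨M.mul x y, h.mul _ x.2 _ y.2⟩
  neg x := ⟨M.neg x, h.neg _ x.2⟩
  zero := ⟨M.zero, h.zero⟩
  one := ⟨M.one, h.one⟩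
  c i x := ⟨M.c i x, h.c i _ x.2⟩
  d i j := ⟨M.d i j, h.d i j⟩

theorem IsCA.subAlg {ι : Type v} {M : RawCA.{u, v} ι} (hM : M.IsCA) {S : Set M.carrier}
    (h : M.IsSubuniverse S) : (M.subAlg S h).IsCA := by
  obtain ⟨⟨b1, b2, b3, b4, b5, b6, b7, b8⟩, h1, h2, h3, h4, h5, h6, h7⟩ := hM
  exact ⟨⟨fun x y => Subtype.ext (b1 x.1 y.1), fun x y => Subtype.ext (b2 x.1 y.1),
    fun x y z => Subtype.ext (b3 x.1 y.1 z.1), fun x y z => Subtype.ext (b4 x.1 y.1 z.1),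
    fun x => Subtype.ext (b5 x.1), fun x => Subtype.ext (b6 x.1),
    fun x => Subtype.ext (b7 x.1), fun x => Subtype.ext (b8 x.1)⟩,
    fun i => Subtype.ext (h1 i), fun i x => Subtype.ext (h2 i x.1),
    fun i x y => Subtype.ext (h3 i x.1 y.1), fun i j x => Subtype.ext (h4 i j x.1),
    fun i => Subtype.ext (h5 i), fun i j k hj hk => Subtype.ext (h6 i j k hj hk),
    fun i j x hij => Subtype.ext (h7 i j x.1 hij)⟩

theorem isSubuniverse_inSubalg {ι : Type v} (M : RawCA.{u, v} ι) (X : Set M.carrier) :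
    M.IsSubuniverse {b | InSubalg M X b} :=
  ⟨fun _ hx _ hy => .add hx hy, fun _ hx _ hy => .mul hx hy, fun _ hx => .neg hx, .zero, .one,
    fun i _ hx => .cyl i hx, fun i j => .diag i j⟩

/-- The subalgebra of `M` generated by `X`. -/
def generated {ι : Type v} (M : RawCA.{u, v} ι) (X : Set M.carrier) : RawCA.{u, v} ι :=
  M.subAlg _ (M.isSubuniverse_inSubalg X)

theorem generates_generated {ι : Type v} (M : RawCA.{u, v} ι) (X : Set M.carrier)
    (Y : Set (M.generated X).carrier) (hY : ∀ x (hx : x ∈ X), ⟨x, .base hx⟩ ∈ Y) :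
    (M.generated X).Generates Y := by
  rintro ⟨b, hb⟩
  change InSubalg M X b at hb
  induction hb with
  | base hx => exact .base (hY _ hx)
  | zero => exact .zero
  | one => exact .one
  | add _ _ h₁ h₂ => exact .add h₁ h₂
  | mul _ _ h₁ h₂ => exact .mul h₁ h₂
  | neg _ h₁ => exact .neg h₁
  | cyl i _ h₁ => exact .cyl i h₁
  | diag i j => exact .diag i j

theorem IsCA.prodAlg {ι : Type v} {I : Type w} {F : I → RawCA.{u, v} ι}
    (hF : ∀ a, (F a).IsCA) : (prodAlg F).IsCA := by
  refine ⟨⟨fun x y => funext fun a => ?_, fun x y => funext fun a => ?_,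
    fun x y z => funext fun a => ?_, fun x y z => funext fun a => ?_,
    fun x => funext fun a => ?_, fun x => funext fun a => ?_,
    fun x => funext fun a => ?_, fun x => funext fun a => ?_⟩,
    fun i => funext fun a => ?_, fun i x => funext fun a => ?_,
    fun i x y => funext fun a => ?_, fun i j x => funext fun a => ?_,
    fun i => funext fun a => ?_, fun i j k hj hk => funext fun a => ?_,
    fun i j x hij => funext fun a => ?_⟩ <;>
  obtain ⟨⟨b1, b2, b3, b4, b5, b6, b7, b8⟩, h1, h2, h3, h4, h5, h6, h7⟩ := hF a
  · exact b1 _ _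
  · exact b2 _ _
  · exact b3 _ _ _
  · exact b4 _ _ _
  · exact b5 _
  · exact b6 _
  · exact b7 _
  · exact b8 _
  · exact h1 _
  · exact h2 _ _
  · exact h3 _ _ _
  · exact h4 _ _ _
  · exact h5 _
  · exact h6 _ _ _ hj hk
  · exact h7 _ _ _ hij

/-- In a cylindric algebra `{0}` is an ideal. -/
theorem IsCA.isIdeal_zero {ι : Type v} {M : RawCA.{u, v} ι} (hM : M.IsCA) :
    M.IsIdeal {M.zero} := by
  obtain ⟨⟨-, -, -, -, b5, -⟩, h1, -⟩ := hM
  refine ⟨rfl, ?_, ?_, ?_⟩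
  · rintro x rfl y rfl
    exact b5 _
  · rintro x rfl y hy
    exact (b5 y).symm.trans hy
  · rintro x rfl i
    exact h1 i

end RawCA

theorem mem_cylSet {ι : Type v} {U : Type u} {i : ι} {X : Set (ι → U)} {s : ι → U}
    [DecidableEq ι] : s ∈ cylSet ι U i X ↔ ∃ u, Function.update s i u ∈ X := by
  constructor
  · rintro ⟨t, ht, h⟩
    refine ⟨t i, ?_⟩
    convert ht
    funext j
    by_cases hj : j = i
    · subst hj; simp
    · simp [hj, h j hj]
  · rintro ⟨u, hu⟩
    exact ⟨_, hu, fun j hj => by simp [hj]⟩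

theorem mem_cylSet_diagSet {κ : Type v} {U : Type u} [DecidableEq κ] {a b : κ} (hab : a ≠ b)
    {Y : Set (κ → U)} {s : κ → U} :
    s ∈ cylSet κ U a (diagSet κ U a b ∩ Y) ↔ Function.update s a (s b) ∈ Y := by
  simp only [mem_cylSet, Set.mem_inter_iff, diagSet, Set.mem_ofPred_eq, Function.update_self,
    Function.update_of_ne hab.symm]
  exact ⟨fun ⟨u, h, hu⟩ => h ▸ hu, fun h => ⟨_, rfl, h⟩⟩

theorem isCA_fullSetAlg (ι : Type v) (U : Type u) : (fullSetAlg ι U).IsCA := by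
  classical
  refine ⟨⟨Set.union_comm, Set.inter_comm, Set.union_inter_distrib_left,
    Set.inter_union_distrib_left, Set.union_empty, Set.inter_univ, Set.union_compl_self,
    Set.inter_compl_self⟩, ?_, ?_, ?_, ?_, ?_, ?_, ?_⟩
  · intro i
    exact Set.eq_empty_of_forall_notMem fun s ⟨t, ht, _⟩ => ht
  · intro i x
    exact Set.union_eq_right.2 fun s hs => ⟨s, hs, fun _ _ => rfl⟩
  · intro i (x : Set (ι → U)) (y : Set (ι → U))
    change cylSet ι U i (x ∩ cylSet ι U i y) = cylSet ι U i x ∩ cylSet ι U i y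
    ext s
    simp [mem_cylSet]
  · intro i j (x : Set (ι → U))
    change cylSet ι U i (cylSet ι U j x) = cylSet ι U j (cylSet ι U i x)
    ext s
    by_cases hij : i = j
    · rw [hij]
    · simp only [mem_cylSet]
      rw [exists_comm]
      simp only [Function.update_comm hij]
  · intro i
    exact Set.eq_univ_of_forall fun s => rfl
  · intro i j k hj hk
    change diagSet ι U j k = cylSet ι U i (diagSet ι U j i ∩ diagSet ι U i k)
    ext s
    simp [mem_cylSet, diagSet, hj.symm, hk.symm]
  · intro i j x hij
    refine Set.eq_empty_of_forall_notMem ?_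
    rintro s ⟨h₁, h₂⟩
    exact (mem_cylSet_diagSet hij).1 h₂ ((mem_cylSet_diagSet hij).1 h₁)

/-! ### Dilating set algebras -/

/-- The power, with exponent `I`, of the full set algebra with base `U`. -/
abbrev powAlg (I : Type w) (ι : Type v) (U : Type u) : RawCA.{max v u w, v} ι :=
  prodAlg fun _ : I => fullSetAlg ι U

theorem isCA_powAlg (I : Type w) (ι : Type v) (U : Type u) : (powAlg I ι U).IsCA :=
  RawCA.IsCA.prodAlg fun _ => isCA_fullSetAlg ι U

theorem representable_subAlg {I ι U : Type u} {S : Set (powAlg I ι U).carrier}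
    (h : (powAlg I ι U).IsSubuniverse S) : ((powAlg I ι U).subAlg S h).Representable :=
  ⟨I, fun _ => U, Subtype.val, Subtype.val_injective, fun _ _ => rfl, fun _ _ => rfl,
    fun _ => rfl, rfl, rfl, fun _ _ => rfl, fun _ _ => rfl⟩

/-- The component of `Y` at the index `e`. -/
def coord {I : Type w} {ι : Type v} {U : Type u} (Y : (powAlg I ι U).carrier) (e : I) :
    Set (ι → U) := Y e

/-- The sets of `(ι ⊕ ℕ)`-sequences whose restriction to `ι` lies in the given sets. -/
def dilate {I ι U : Type u} (Y : (powAlg I ι U).carrier) : (powAlg I (ι ⊕ ℕ) U).carrier :=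
  fun a => ({s | s ∘ Sum.inl ∈ coord Y a} : Set (ι ⊕ ℕ → U))

theorem cylSet_preimage {ι U : Type u} (i : ι) (Y : Set (ι → U)) :
    ({s | s ∘ Sum.inl ∈ cylSet ι U i Y} : Set (ι ⊕ ℕ → U)) =
      cylSet (ι ⊕ ℕ) U (Sum.inl i) {s | s ∘ Sum.inl ∈ Y} := by
  classical
  ext s
  simp only [mem_cylSet, Set.mem_ofPred_eq]
  simp only [Sum.update_inl_comp_inl]

theorem cylSet_inr_preimage {ι U : Type u} (n : ℕ) (Y : Set (ι → U)) :
    cylSet (ι ⊕ ℕ) U (Sum.inr n) {s | s ∘ Sum.inl ∈ Y} = {s | s ∘ Sum.inl ∈ Y} := by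
  classical
  ext s
  simp only [mem_cylSet, Set.mem_ofPred_eq, Sum.update_inr_comp_inl]
  exact ⟨fun ⟨_, h⟩ => h, fun h => ⟨s (Sum.inr n), h⟩⟩

theorem preimage_injective {ι U : Type u} [Nonempty U] :
    Function.Injective fun Y : Set (ι → U) => ({s | s ∘ Sum.inl ∈ Y} : Set (ι ⊕ ℕ → U)) := by
  intro Y Z h
  ext r
  obtain ⟨u⟩ := ‹Nonempty U›
  exact Set.ext_iff.1 h (Sum.elim r fun _ => u)

theorem dilate_injective {I ι U : Type u} [Nonempty U] :
    Function.Injective (dilate : (powAlg I ι U).carrier → _) := fun _ _ h =>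
  funext fun a => preimage_injective (congrFun h a)

theorem dilate_c {I ι U : Type u} (i : ι) (Y : (powAlg I ι U).carrier) :
    dilate ((powAlg I ι U).c i Y) = (powAlg I (ι ⊕ ℕ) U).c (Sum.inl i) (dilate Y) :=
  funext fun a => cylSet_preimage i (Y a)

/-- The subalgebra generated by the dilations of the elements of `S`. -/
abbrev dilation {I ι U : Type u} (S : Set (powAlg I ι U).carrier) : RawCA.{u, u} (ι ⊕ ℕ) :=
  (powAlg I (ι ⊕ ℕ) U).generated (dilate '' S)

theorem isNeatEmbedding_dilate {I ι U : Type u} [Nonempty U] {S : Set (powAlg I ι U).carrier}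
    {T : Set (powAlg I ι U).carrier} (hT : (powAlg I ι U).IsSubuniverse T)
    (h : ∀ Y ∈ T, InSubalg (powAlg I (ι ⊕ ℕ) U) (dilate '' S) (dilate Y)) :
    IsNeatEmbedding ((powAlg I ι U).subAlg T hT) (dilation S) Sum.inl
      (fun Y => ⟨dilate Y.1, h _ Y.2⟩) := by
  refine ⟨fun Y Z hYZ => Subtype.ext (dilate_injective (congrArg Subtype.val hYZ)),
    fun _ _ => rfl, fun _ _ => rfl, fun _ => rfl, rfl, rfl,
    fun i Y => Subtype.ext (dilate_c i Y.1), fun _ _ => rfl, ?_⟩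
  rintro Y (k | n) hk
  · exact absurd ⟨k, rfl⟩ hk
  · exact Subtype.ext (funext fun a => cylSet_inr_preimage n (Y.1 a))

theorem generates_dilation {I ι U : Type u} {S : Set (powAlg I ι U).carrier}
    {T : Set (powAlg I ι U).carrier} (hT : (powAlg I ι U).IsSubuniverse T)
    (h : ∀ Y ∈ T, InSubalg (powAlg I (ι ⊕ ℕ) U) (dilate '' S) (dilate Y)) (hST : S ⊆ T) :
    (dilation S).Generates (Set.range fun Y : ((powAlg I ι U).subAlg T hT).carrier =>
      (⟨dilate Y.1, h _ Y.2⟩ : (dilation S).carrier)) := by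
  refine RawCA.generates_generated _ _ _ ?_
  rintro _ ⟨Y, hY, rfl⟩
  exact ⟨⟨Y, hST hY⟩, rfl⟩

/-- All elements whose dilation lies in the algebra generated by the dilation of `S`. -/
def neatClosure {I ι U : Type u} (S : Set (powAlg I ι U).carrier) :
    Set (powAlg I ι U).carrier :=
  {Y | InSubalg (powAlg I (ι ⊕ ℕ) U) (dilate '' S) (dilate Y)}

theorem subset_neatClosure {I ι U : Type u} (S : Set (powAlg I ι U).carrier) :
    S ⊆ neatClosure S := fun Y hY => .base ⟨Y, hY, rfl⟩

theorem isSubuniverse_neatClosure {I ι U : Type u} (S : Set (powAlg I ι U).carrier) :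
    (powAlg I ι U).IsSubuniverse (neatClosure S) where
  add _ hx _ hy := InSubalg.add hx hy
  mul _ hx _ hy := InSubalg.mul hx hy
  neg _ hx := InSubalg.neg hx
  zero := InSubalg.zero
  one := InSubalg.one
  c i x hx := by
    change InSubalg _ _ _
    rw [dilate_c]
    exact InSubalg.cyl _ hx
  d i j := InSubalg.diag (Sum.inl i) (Sum.inl j)

/-- The term defining the transposition of the coordinates `a` and `b`, with the spare
coordinate `k`. -/
def swapTerm {κ : Type v} (M : RawCA.{u, v} κ) (k a b : κ) (x : M.carrier) : M.carrier :=
  M.c k (M.mul (M.d k a) (M.c a (M.mul (M.d a b) (M.c b (M.mul (M.d b k) x)))))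

theorem InSubalg.swapTerm {κ : Type v} {M : RawCA.{u, v} κ} {X : Set M.carrier} {x : M.carrier}
    (hx : InSubalg M X x) (k a b : κ) : InSubalg M X (swapTerm M k a b x) :=
  .cyl _ (.mul (.diag _ _) (.cyl _ (.mul (.diag _ _) (.cyl _ (.mul (.diag _ _) hx)))))

theorem swapTerm_dilate {I ι U : Type u} [DecidableEq ι] {a b : ι} (hab : a ≠ b)
    (Y : (powAlg I ι U).carrier) :
    swapTerm (powAlg I (ι ⊕ ℕ) U) (Sum.inr 0) (Sum.inl a) (Sum.inl b) (dilate Y) =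
      dilate (I := I) fun e => ({r | r ∘ Equiv.swap a b ∈ coord Y e} : Set (ι → U)) := by
  funext e
  refine Set.ext fun s => ?_
  refine (mem_cylSet_diagSet (by simp)).trans <| (mem_cylSet_diagSet (by simpa)).trans <|
    (mem_cylSet_diagSet (by simp)).trans ?_
  change _ ∘ Sum.inl ∈ coord Y e ↔ (s ∘ Sum.inl) ∘ Equiv.swap a b ∈ coord Y e
  refine iff_of_eq (congrArg (· ∈ coord Y e) (funext fun j => ?_))
  by_cases hb : j = b
  · subst hb; simp
  by_cases ha : j = a
  · subst ha; simp [hab]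
  · simp [Equiv.swap_apply_of_ne_of_ne ha hb, ha, hb]

/-! ### Parity colourings of sequences -/

theorem exists_parity (ι : Type u) :
    ∃ φ : (ι → ZMod 2) →ₗ[ZMod 2] ZMod 2, ∀ [DecidableEq ι] i, φ (Pi.single i 1) = 1 := by
  obtain ⟨g, hg⟩ := LinearMap.exists_leftInverse_of_injective
    (Finsupp.lcoeFun : (ι →₀ ZMod 2) →ₗ[ZMod 2] ι → ZMod 2)
    (LinearMap.ker_eq_bot.2 DFunLike.coe_injective)
  refine ⟨Finsupp.linearCombination (ZMod 2) (fun _ : ι => (1 : ZMod 2)) ∘ₗ g, @fun _ i => ?_⟩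
  have h : g (Pi.single i 1) = Finsupp.single i 1 := by
    rw [← Finsupp.single_eq_pi_single]
    exact LinearMap.congr_fun hg (Finsupp.single i 1)
  simp [h]

/-- A linear functional on `ι → ZMod 2` which takes the value `1` on each unit vector. -/
noncomputable def parity (ι : Type u) : (ι → ZMod 2) →ₗ[ZMod 2] ZMod 2 :=
  (exists_parity ι).choose

theorem parity_update {ι : Type u} [DecidableEq ι] (f : ι → ZMod 2) (i : ι) (a : ZMod 2) :
    parity ι (Function.update f i a) = parity ι f + (a - f i) := by
  have h : Function.update f i a = f + (a - f i) • Pi.single i (1 : ZMod 2) := by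
    funext j
    by_cases hj : j = i
    · subst hj; simp
    · simp [hj]
  have h₁ : parity ι (Pi.single i 1) = 1 := (exists_parity ι).choose_spec i
  rw [h, map_add, map_smul, h₁, smul_eq_mul, mul_one]

theorem parity_comp_swap {ι : Type u} [DecidableEq ι] {a b : ι} (hab : a ≠ b)
    (f : ι → ZMod 2) : parity ι (f ∘ Equiv.swap a b) = parity ι f := by
  have h : f ∘ Equiv.swap a b = Function.update (Function.update f a (f b)) b (f a) := by
    funext j
    by_cases hb : j = b
    · subst hb; simp
    by_cases ha : j = a
    · subst ha; simp [hab]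
    · simp [Equiv.swap_apply_of_ne_of_ne ha hb, ha, hb]
  rw [h, parity_update, parity_update, Function.update_of_ne hab.symm]
  ring

/-- A set too large to be exhausted by an `ι`-sequence, with each point doubled. -/
abbrev Base (ι : Type u) : Type u := Set (Option ι) × ZMod 2

/-- An injective `ι`-sequence in `Base ι`. -/
def point {ι : Type u} (i : ι) : Base ι := ({some i}, 0)

theorem point_injective {ι : Type u} : Function.Injective (point : ι → Base ι) := by
  intro i j h
  simpa [point] using h

open Classical in
/-- Two colourings of `ι`-sequences: the parity of the second components, which is symmetric
in all coordinates, and its modification according to the value of the coordinate `p`. -/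
noncomputable def colour {ι : Type u} (p : ι) (e : Bool) (s : ι → Base ι) : ZMod 2 :=
  parity ι (fun i => (s i).2) + if e = true ∧ s p = point p then 1 else 0

theorem exists_fresh {ι : Type u} [DecidableEq ι] (p : ι) (e : Bool) (s : ι → Base ι) (i : ι)
    (c : ZMod 2) : ∃ u, (∀ j, u ≠ s j) ∧ colour p e (Function.update s i u) = c := by
  obtain ⟨k, hk⟩ : ∃ k : Set (Option ι), ∀ o : Option ι,
      o.elim (point p).1 (fun j => (s j).1) ≠ k := by
    by_contra! h
    exact Function.cantor_surjective _ h
  have hp : ∀ a, ((k, a) : Base ι) ≠ point p := fun a h => hk none (congrArg Prod.fst h).symm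
  have h : ∀ a, colour p e (Function.update s i (k, a)) = parity ι (fun j => (s j).2) +
      (a - (s i).2) + if e = true ∧ i ≠ p ∧ s p = point p then 1 else 0 := by
    intro a
    have h₁ : (fun j => (Function.update s i ((k, a) : Base ι) j).2) =
        Function.update (fun j => (s j).2) i a := by
      funext j
      by_cases hj : j = i
      · subst hj; simp
      · simp [hj]
    rw [colour, h₁, parity_update]
    by_cases hi : i = p
    · subst hi; simp [hp]
    · simp [Function.update_of_ne (Ne.symm hi), hi]
  refine ⟨(k, c - parity ι (fun j => (s j).2) + (s i).2 -
    if e = true ∧ i ≠ p ∧ s p = point p then 1 else 0), fun j hj => ?_, ?_⟩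
  · exact hk (some j) (congrArg Prod.fst hj).symm
  · rw [h]
    ring

theorem colour_false_swap {ι : Type u} [DecidableEq ι] {a b : ι} (hab : a ≠ b) (p : ι)
    (s : ι → Base ι) : colour p false (s ∘ Equiv.swap a b) = colour p false s := by
  simpa [colour, Function.comp_def] using parity_comp_swap hab fun i => (s i).2

theorem colour_true_swap {ι : Type u} [DecidableEq ι] {p q : ι} (hpq : p ≠ q)
    {s : ι → Base ι} (hs : Function.Injective s) (hp : s p = point p) :
    colour p true (s ∘ Equiv.swap p q) ≠ colour p true s := by
  have hq : s q ≠ point p := fun h => hpq (hs (hp.trans h.symm))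
  have h := parity_comp_swap hpq fun i => (s i).2
  simp only [Function.comp_def] at h
  simp [colour, hp, hq, h]

theorem update_injective_of_fresh {ι : Type v} {U : Type u} [DecidableEq ι] {s : ι → U}
    (hs : Function.Injective s) {i : ι} {u : U} (hu : ∀ j, u ≠ s j) :
    Function.Injective (Function.update s i u) := by
  intro a b h
  by_cases ha : a = i <;> by_cases hb : b = i
  · rw [ha, hb]
  · subst ha
    simp [hb, hu] at h
  · subst hb
    simp [ha, (hu _).symm] at h
  · simpa [ha, hb, hs.eq_iff] using h

theorem exists_injective_colour {ι : Type u} {p q : ι} (hpq : p ≠ q) (e : Bool) (c : ZMod 2) :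
    ∃ s : ι → Base ι, Function.Injective s ∧ s p = point p ∧ colour p e s = c := by
  classical
  obtain ⟨u, hu, hc⟩ := exists_fresh p e point q c
  exact ⟨_, update_injective_of_fresh point_injective hu, by simp [hpq], hc⟩

/-- The sequences `s` and `t` have the same kernel and, if they are injective, the same colour
for the colourings given by `e` and `e'`, respectively. -/
def Alike {ι : Type u} (p : ι) (e : Bool) (s : ι → Base ι) (e' : Bool) (t : ι → Base ι) :
    Prop :=
  (∀ a b, s a = s b ↔ t a = t b) ∧ (Function.Injective s → colour p e s = colour p e' t)

theorem Alike.injective {ι : Type u} {p : ι} {e e' : Bool} {s t : ι → Base ι}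
    (h : Alike p e s e' t) (hs : Function.Injective s) : Function.Injective t :=
  fun a b hab => hs ((h.1 a b).2 hab)

theorem Alike.symm {ι : Type u} {p : ι} {e e' : Bool} {s t : ι → Base ι}
    (h : Alike p e s e' t) : Alike p e' t e s :=
  ⟨fun a b => (h.1 a b).symm, fun ht => (h.2 fun a b hab => ht ((h.1 a b).1 hab)).symm⟩

theorem Alike.exists_update {ι : Type u} [DecidableEq ι] {p : ι} {e e' : Bool}
    {s t : ι → Base ι} (h : Alike p e s e' t) (i : ι) (u : Base ι) :
    ∃ v, Alike p e (Function.update s i u) e' (Function.update t i v) := by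
  by_cases hu : ∃ j, j ≠ i ∧ u = s j
  · obtain ⟨j, hj, rfl⟩ := hu
    refine ⟨t j, fun a b => ?_, fun hs => ?_⟩
    · by_cases ha : a = i <;> by_cases hb : b = i <;> simp [ha, hb, h.1]
    · exact absurd (hs (a₁ := j) (a₂ := i) (by simp [hj])) hj
  · push Not at hu
    obtain ⟨v, hv, hc⟩ := exists_fresh p e' t i (colour p e (Function.update s i u))
    refine ⟨v, fun a b => ?_, fun _ => hc.symm⟩
    by_cases ha : a = i <;> by_cases hb : b = i
    · simp [ha, hb]
    · simp [ha, hb, hv, hu]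
    · simp [ha, hb, (hv _).symm, (hu _ ha).symm]
    · simp [ha, hb, h.1]

theorem exists_alike {ι : Type u} (p : ι) (e e' : Bool) (s : ι → Base ι) :
    ∃ t, Alike p e s e' t := by
  classical
  by_cases hs : Function.Injective s
  · obtain ⟨u, hu, hc⟩ := exists_fresh p e' s p (colour p e s)
    have ht := update_injective_of_fresh (i := p) hs hu
    exact ⟨_, fun a b => by rw [hs.eq_iff, ht.eq_iff], fun _ => hc.symm⟩
  · exact ⟨s, fun _ _ => Iff.rfl, fun h => absurd h hs⟩

/-! ### The algebras -/

/-- The square of the full set algebra with base `Base ι`. -/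
abbrev Square (ι κ : Type u) : RawCA.{u, u} κ := powAlg (ULift.{u} Bool) κ (Base ι)

/-- The pairs of sets which do not distinguish alike sequences. -/
def alikeSets {ι : Type u} (p : ι) : Set (Square ι ι).carrier :=
  {Y | ∀ e e' s t, Alike p e s e' t → (s ∈ coord Y ⟨e⟩ ↔ t ∈ coord Y ⟨e'⟩)}

theorem isSubuniverse_alikeSets {ι : Type u} (p : ι) :
    (Square ι ι).IsSubuniverse (alikeSets p) where
  add _ hX _ hY e e' s t h := or_congr (hX e e' s t h) (hY e e' s t h)
  mul _ hX _ hY e e' s t h := and_congr (hX e e' s t h) (hY e e' s t h)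
  neg _ hX e e' s t h := not_congr (hX e e' s t h)
  zero _ _ _ _ _ := Iff.rfl
  one _ _ _ _ _ := Iff.rfl
  d i j _ _ _ _ h := h.1 i j
  c i X hX := by
    classical
    have key : ∀ e e' s t, Alike p e s e' t →
        s ∈ cylSet ι (Base ι) i (coord X ⟨e⟩) → t ∈ cylSet ι (Base ι) i (coord X ⟨e'⟩) := by
      intro e e' s t h hs
      obtain ⟨u, hu⟩ := mem_cylSet.1 hs
      obtain ⟨v, hv⟩ := h.exists_update i u
      exact mem_cylSet.2 ⟨v, (hX _ _ _ _ hv).1 hu⟩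
    exact fun e e' s t h => ⟨key _ _ _ _ h, key _ _ _ _ h.symm⟩

theorem eq_zero_of_mem_alikeSets {ι : Type u} {p : ι} {Y : (Square ι ι).carrier}
    (hY : Y ∈ alikeSets p) {e : Bool} (h : coord Y ⟨e⟩ = ∅) : Y = (Square ι ι).zero := by
  refine funext fun ⟨e'⟩ => Set.eq_empty_of_forall_notMem fun s hs => ?_
  obtain ⟨t, ht⟩ := exists_alike p e' e s
  have h₁ : t ∈ coord Y ⟨e⟩ := (hY _ _ _ _ ht).1 hs
  exact (h ▸ h₁ : t ∈ (∅ : Set (ι → Base ι)))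

/-- The injective sequences of colour `c`. -/
def colourClass {ι : Type u} (p : ι) (c : ZMod 2) : (Square ι ι).carrier :=
  fun e => ({s | Function.Injective s ∧ colour p e.down s = c} : Set (ι → Base ι))

theorem colourClass_mem {ι : Type u} (p : ι) (c : ZMod 2) :
    colourClass p c ∈ alikeSets p := by
  refine fun e e' s t h => ⟨?_, ?_⟩
  · exact fun ⟨hs, hc⟩ => ⟨h.injective hs, (h.2 hs).symm.trans hc⟩
  · exact fun ⟨ht, hc⟩ => ⟨h.symm.injective ht, (h.symm.2 ht).symm.trans hc⟩

/-- The sequences of colour class `0` which leave it when the coordinates `p`, `q` are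
exchanged. -/
def asymmetric {ι : Type u} [DecidableEq ι] (p q : ι) : (Square ι ι).carrier :=
  (Square ι ι).mul (colourClass p 0) ((Square ι ι).neg fun e =>
    ({r | r ∘ Equiv.swap p q ∈ coord (colourClass p 0) e} : Set (ι → Base ι)))

theorem asymmetric_mem {ι : Type u} [DecidableEq ι] {p q : ι} (hpq : p ≠ q) :
    asymmetric p q ∈ neatClosure (alikeSets p) := by
  have h : InSubalg (Square ι (ι ⊕ ℕ)) (dilate '' alikeSets p) (dilate (colourClass p 0)) :=
    .base ⟨_, colourClass_mem p 0, rfl⟩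
  have h₁ := h.swapTerm (Sum.inr 0) (Sum.inl p) (Sum.inl q)
  rw [swapTerm_dilate hpq] at h₁
  exact h.mul h₁.neg

theorem coord_asymmetric_false {ι : Type u} [DecidableEq ι] {p q : ι} (hpq : p ≠ q) :
    coord (asymmetric p q) ⟨false⟩ = ∅ := by
  refine Set.eq_empty_of_forall_notMem ?_
  rintro s ⟨⟨hs, hc⟩, h⟩
  exact h ⟨hs.comp (Equiv.injective _), (colour_false_swap hpq p s).trans hc⟩

theorem coord_asymmetric_true_nonempty {ι : Type u} [DecidableEq ι] {p q : ι} (hpq : p ≠ q) :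
    (coord (asymmetric p q) ⟨true⟩).Nonempty := by
  obtain ⟨s, hs, hp, hc⟩ := exists_injective_colour hpq true 0
  exact ⟨s, ⟨hs, hc⟩, fun h => colour_true_swap hpq hs hp (h.2.trans hc.symm)⟩

theorem ne_zero_of_mem_coord {ι : Type u} {Y : (Square ι ι).carrier} {e : ULift.{u} Bool}
    {s : ι → Base ι} (h : s ∈ coord Y e) : Y ≠ (Square ι ι).zero := by
  rintro rfl
  exact h

theorem asymmetric_ne_zero {ι : Type u} [DecidableEq ι] {p q : ι} (hpq : p ≠ q) :
    asymmetric p q ≠ (Square ι ι).zero :=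
  ne_zero_of_mem_coord (coord_asymmetric_true_nonempty hpq).some_mem

/-- The element `x` is disjoint from all proper diagonals. -/
def RawCA.Discrete {ι : Type v} (M : RawCA.{u, v} ι) (x : M.carrier) : Prop :=
  ∀ i j, i ≠ j → M.mul x (M.d i j) = M.zero

/-- There are three nonzero pairwise disjoint elements which are disjoint from all proper
diagonals. -/
def RawCA.HasDiscreteTriple {ι : Type v} (M : RawCA.{u, v} ι) : Prop :=
  ∃ x : Fin 3 → M.carrier, (∀ k, M.Discrete (x k)) ∧ (∀ k, x k ≠ M.zero) ∧
    ∀ k l, k ≠ l → M.mul (x k) (x l) = M.zero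

theorem RawCA.HasDiscreteTriple.of_iso {ι : Type v} {M : RawCA.{u, v} ι} {N : RawCA.{w, v} ι}
    (hN : N.HasDiscreteTriple) {g : M.carrier → N.carrier} (hg : Function.Bijective g)
    (h : IsHom M N g) : M.HasDiscreteTriple := by
  obtain ⟨x, hd, h0, hx⟩ := hN
  obtain ⟨-, hmul, -, hzero, -, -, hdiag⟩ := h
  choose y hy using fun k => hg.2 (x k)
  refine ⟨y, fun k i j hij => hg.1 ?_, fun k hk => h0 k ?_, fun k l hkl => hg.1 ?_⟩
  · rw [hmul, hy, hdiag, hzero, hd k i j hij]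
  · rw [← hy, hk, hzero]
  · rw [hmul, hy, hy, hzero, hx k l hkl]

theorem injective_of_discrete {ι : Type u} {Y : (Square ι ι).carrier}
    (hY : (Square ι ι).Discrete Y) {e : ULift.{u} Bool} {s : ι → Base ι} (hs : s ∈ coord Y e) :
    Function.Injective s := by
  intro i j hij
  by_contra hne
  have h : coord ((Square ι ι).mul Y ((Square ι ι).d i j)) e = ∅ := by
    rw [hY i j hne]; rfl
  exact (h ▸ (⟨hs, hij⟩ : s ∈ coord ((Square ι ι).mul Y ((Square ι ι).d i j)) e) :
    s ∈ (∅ : Set (ι → Base ι)))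

/-- The algebra of pairs of sets which do not distinguish alike sequences. -/
def alikeAlg {ι : Type u} (p : ι) : RawCA.{u, u} ι :=
  (Square ι ι).subAlg _ (isSubuniverse_alikeSets p)

/-- The extension of `alikeAlg p` by the elements obtained in its dilation. -/
def neatAlg {ι : Type u} (p : ι) : RawCA.{u, u} ι :=
  (Square ι ι).subAlg _ (isSubuniverse_neatClosure (alikeSets p))

theorem not_hasDiscreteTriple_alikeAlg {ι : Type u} (p : ι) :
    ¬ (alikeAlg p).HasDiscreteTriple := by
  rintro ⟨x, hd, h0, hx⟩
  have hs : ∀ k, ∃ s, s ∈ coord (x k).1 ⟨false⟩ := by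
    intro k
    by_contra! h
    exact h0 k (Subtype.ext (eq_zero_of_mem_alikeSets (x k).2
      (Set.eq_empty_of_forall_notMem h)))
  choose s hs using hs
  obtain ⟨k, l, hkl, hc⟩ := Fintype.exists_ne_map_eq_of_card_lt
    (fun k => colour p false (s k)) (by simp [ZMod.card])
  have hinj : ∀ k, Function.Injective (s k) := fun k =>
    injective_of_discrete (fun i j hij => congrArg Subtype.val (hd k i j hij)) (hs k)
  have hkl_alike : Alike p false (s k) false (s l) :=
    ⟨fun a b => by rw [(hinj k).eq_iff, (hinj l).eq_iff], fun _ => hc⟩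
  have h : coord ((Square ι ι).mul (x k).1 (x l).1) ⟨false⟩ = ∅ :=
    congrArg (fun y : (alikeAlg p).carrier => coord y.1 ⟨false⟩) (hx k l hkl)
  exact (h ▸ (⟨((x k).2 _ _ _ _ hkl_alike).1 (hs k), hs l⟩ :
    s l ∈ coord ((Square ι ι).mul (x k).1 (x l).1) ⟨false⟩) : s l ∈ (∅ : Set (ι → Base ι)))

theorem discrete_of_injective {ι : Type u} {Y : (Square ι ι).carrier}
    (hY : ∀ e, ∀ s ∈ coord Y e, Function.Injective s) : (Square ι ι).Discrete Y :=
  fun _ _ hij => funext fun e => Set.eq_empty_of_forall_notMem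
    fun s hs => hij (hY e s hs.1 hs.2)

theorem hasDiscreteTriple_neatAlg {ι : Type u} {p q : ι} (hpq : p ≠ q) :
    (neatAlg p).HasDiscreteTriple := by
  classical
  have hN := isSubuniverse_neatClosure (alikeSets p)
  have hE := asymmetric_mem hpq
  have hX : ∀ c, colourClass p c ∈ neatClosure (alikeSets p) := fun c =>
    subset_neatClosure _ (colourClass_mem p c)
  obtain ⟨s₀, hs₀, -, hc₀⟩ := exists_injective_colour hpq false 0
  obtain ⟨s₁, hs₁, -, hc₁⟩ := exists_injective_colour hpq false 1
  let y : Fin 3 → (Square ι ι).carrier := ![asymmetric p q,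
    (Square ι ι).mul (colourClass p 0) ((Square ι ι).neg (asymmetric p q)), colourClass p 1]
  have hy : ∀ k, y k ∈ neatClosure (alikeSets p) := by
    intro k
    fin_cases k
    · exact hE
    · exact hN.mul _ (hX 0) _ (hN.neg _ hE)
    · exact hX 1
  have hdisj : ∀ k l, k < l → (Square ι ι).mul (y k) (y l) = (Square ι ι).zero := by
    intro k l hkl
    refine funext fun e => Set.eq_empty_of_forall_notMem fun s hs => ?_
    have h01 : ∀ s, s ∈ coord (colourClass p 0) e → s ∈ coord (colourClass p 1) e → False :=
      fun s h h' => zero_ne_one (h.2.symm.trans h'.2)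
    fin_cases k <;> fin_cases l <;> try exact absurd hkl (by decide)
    · exact hs.2.2 hs.1
    · exact h01 s hs.1.1 hs.2
    · exact h01 s hs.1.1 hs.2
  have hne : ∀ k, y k ≠ (Square ι ι).zero := by
    intro k
    fin_cases k
    · exact asymmetric_ne_zero hpq
    · refine ne_zero_of_mem_coord (e := ⟨false⟩) (s := s₀) ⟨⟨hs₀, hc₀⟩, fun h => ?_⟩
      have h : s₀ ∈ coord (asymmetric p q) ⟨false⟩ := h
      rwa [coord_asymmetric_false hpq] at h
    · exact ne_zero_of_mem_coord (e := ⟨false⟩) (s := s₁) ⟨hs₁, hc₁⟩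
  refine ⟨fun k => ⟨y k, hy k⟩, fun k i j hij => Subtype.ext ?_, fun k hk => ?_,
    fun k l hkl => Subtype.ext ?_⟩
  · refine discrete_of_injective (fun e s hs => ?_) i j hij
    fin_cases k
    · exact hs.1.1
    · exact hs.1.1
    · exact hs.1
  · exact hne k (congrArg Subtype.val hk)
  · rcases lt_or_gt_of_ne hkl with h | h
    · exact hdisj k l h
    · exact ((isCA_powAlg _ _ _).1.2.1 _ _).trans (hdisj l k h)

/-- The elements of the dilation whose first component is empty. -/
def firstKernel {ι : Type u} (p : ι) : Set (dilation (alikeSets p)).carrier :=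
  {b | coord b.1 ⟨false⟩ = ∅}

theorem isIdeal_firstKernel {ι : Type u} (p : ι) :
    (dilation (alikeSets p)).IsIdeal (firstKernel p) := by
  obtain ⟨⟨-, -, -, -, b5, -⟩, h1, -⟩ := isCA_fullSetAlg (ι ⊕ ℕ) (Base ι)
  refine ⟨rfl, fun x hx y hy => ?_, fun x hx y hy => ?_, fun x hx i => ?_⟩
  · exact Set.union_empty_iff.2 ⟨hx, hy⟩
  · have h : coord y.1 ⟨false⟩ ∪ coord x.1 ⟨false⟩ = coord x.1 ⟨false⟩ :=
      congrArg (fun z : (dilation (alikeSets p)).carrier => coord z.1 ⟨false⟩) hy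
    rw [show coord x.1 ⟨false⟩ = ∅ from hx, Set.union_empty] at h
    exact h
  · change cylSet (ι ⊕ ℕ) (Base ι) i (coord x.1 ⟨false⟩) = ∅
    rw [show coord x.1 ⟨false⟩ = ∅ from hx]
    exact h1 i

/-- The dilation of the first components of the elements of `alikeAlg p`. -/
def firstDilation {ι : Type u} (p : ι) : RawCA.{u, u} (ι ⊕ ℕ) :=
  (fullSetAlg (ι ⊕ ℕ) (Base ι)).generated ((fun Y => coord (dilate Y) ⟨false⟩) '' alikeSets p)

/-- The embedding of `alikeAlg p` into `firstDilation p`. -/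
def toFirstDilation {ι : Type u} (p : ι) (Y : (alikeAlg p).carrier) :
    (firstDilation p).carrier :=
  ⟨coord (dilate Y.1) ⟨false⟩, .base ⟨Y.1, Y.2, rfl⟩⟩

theorem coord_dilate_injective {ι : Type u} (p : ι) {Y Z : (Square ι ι).carrier}
    (hY : Y ∈ alikeSets p) (hZ : Z ∈ alikeSets p)
    (h : coord (dilate Y) ⟨false⟩ = coord (dilate Z) ⟨false⟩) : Y = Z := by
  have h : coord Y ⟨false⟩ = coord Z ⟨false⟩ := preimage_injective h
  refine funext fun ⟨e⟩ => Set.ext fun s => ?_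
  obtain ⟨t, ht⟩ := exists_alike p e false s
  exact (hY _ _ _ _ ht).trans ((Set.ext_iff.1 h t).trans (hZ _ _ _ _ ht).symm)

theorem isNeatEmbedding_toFirstDilation {ι : Type u} (p : ι) :
    IsNeatEmbedding (alikeAlg p) (firstDilation p) Sum.inl (toFirstDilation p) := by
  refine ⟨fun Y Z h => Subtype.ext (coord_dilate_injective p Y.2 Z.2 (congrArg Subtype.val h)),
    fun _ _ => rfl, fun _ _ => rfl, fun _ => rfl, rfl, rfl,
    fun i Y => Subtype.ext (cylSet_preimage i (Y.1 ⟨false⟩)), fun _ _ => rfl, ?_⟩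
  rintro Y (k | n) hk
  · exact absurd ⟨k, rfl⟩ hk
  · exact Subtype.ext (cylSet_inr_preimage n (Y.1 ⟨false⟩))

theorem generates_toFirstDilation {ι : Type u} (p : ι) :
    (firstDilation p).Generates (Set.range (toFirstDilation p)) := by
  refine RawCA.generates_generated _ _ _ ?_
  rintro _ ⟨Y, hY, rfl⟩
  exact ⟨⟨Y, hY⟩, rfl⟩

/-- A homomorphism which agrees with the first projection on the generators is the first
projection. -/
theorem eq_coord_of_isHom {ι : Type u} {p : ι}
    {g : (dilation (alikeSets p)).carrier → (firstDilation p).carrier}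
    (hg : RawCA.IsHom (dilation (alikeSets p)) (firstDilation p) g)
    (h : ∀ Y : (alikeAlg p).carrier, g ⟨dilate Y.1, .base ⟨Y.1, Y.2, rfl⟩⟩ = toFirstDilation p Y)
    (b : (dilation (alikeSets p)).carrier) : (g b).1 = coord b.1 ⟨false⟩ := by
  obtain ⟨h1, h2, h3, h4, h5, h6, h7⟩ := hg
  obtain ⟨b, hb⟩ := b
  change InSubalg _ _ b at hb
  induction hb with
  | base hx =>
    obtain ⟨Y, hY, rfl⟩ := hx
    exact congrArg Subtype.val (h ⟨Y, hY⟩)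
  | zero => exact congrArg Subtype.val h4
  | one => exact congrArg Subtype.val h5
  | add hx hy ihx ihy =>
    exact (congrArg Subtype.val (h1 ⟨_, hx⟩ ⟨_, hy⟩)).trans
      (congrArg₂ (fullSetAlg (ι ⊕ ℕ) (Base ι)).add ihx ihy)
  | mul hx hy ihx ihy =>
    exact (congrArg Subtype.val (h2 ⟨_, hx⟩ ⟨_, hy⟩)).trans
      (congrArg₂ (fullSetAlg (ι ⊕ ℕ) (Base ι)).mul ihx ihy)
  | neg hx ihx =>
    exact (congrArg Subtype.val (h3 ⟨_, hx⟩)).trans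
      (congrArg (fullSetAlg (ι ⊕ ℕ) (Base ι)).neg ihx)
  | cyl i hx ihx =>
    exact (congrArg Subtype.val (h6 i ⟨_, hx⟩)).trans
      (congrArg ((fullSetAlg (ι ⊕ ℕ) (Base ι)).c i) ihx)
  | diag i j => exact congrArg Subtype.val (h7 i j)

/-- Let α be an infinite ordinal (modelled by an infinite index type `ι`,
with α + ω modelled by `ι ⊕ ℕ`).  Then:
(i) there are non-isomorphic representable `CA_α`'s `A`, `A'` and a single
`B ∈ CA_{α+ω}` such that each of `A`, `A'` is isomorphic to a subalgebra of
`Nr_α B` that generates `B`;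
(ii) there are `A ∈ RCA_α`, `B ∈ CA_{α+ω}` and an ideal `J` of `B` such
that `A ⊆ Nr_α B`, `A` generates `B`, but `Ig^B (J ∩ A) ≠ J`;
(iii) there are `A, A' ∈ RCA_α`, `B, B' ∈ CA_{α+ω}`, embeddings
`e_A : A → Nr_α B`, `e_{A'} : A' → Nr_α B'` whose images generate `B`
resp. `B'`, and an isomorphism `i : A → A'` admitting no isomorphism
`ī : B → B'` with `ī ∘ e_A = e_{A'} ∘ i`. -/
theorem rca_neat_reduct_pathologies {ι : Type u} [Infinite ι] :
    (∃ (A A' : RawCA.{u, u} ι) (B : RawCA.{u, u} (ι ⊕ ℕ))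
        (f : A.carrier → B.carrier) (f' : A'.carrier → B.carrier),
      A.IsCA ∧ A'.IsCA ∧ A.Representable ∧ A'.Representable ∧ B.IsCA ∧
      IsNeatEmbedding A B Sum.inl f ∧ IsNeatEmbedding A' B Sum.inl f' ∧
      B.Generates (Set.range f) ∧ B.Generates (Set.range f') ∧
      ¬ ∃ g : A.carrier → A'.carrier, Function.Bijective g ∧ RawCA.IsHom A A' g) ∧
    (∃ (A : RawCA.{u, u} ι) (B : RawCA.{u, u} (ι ⊕ ℕ))
        (f : A.carrier → B.carrier) (J : Set B.carrier),
      A.IsCA ∧ A.Representable ∧ B.IsCA ∧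
      IsNeatEmbedding A B Sum.inl f ∧ B.Generates (Set.range f) ∧
      B.IsIdeal J ∧ B.IdealGen (J ∩ Set.range f) ≠ J) ∧
    (∃ (A A' : RawCA.{u, u} ι) (B B' : RawCA.{u, u} (ι ⊕ ℕ))
        (eA : A.carrier → B.carrier) (eA' : A'.carrier → B'.carrier)
        (i : A.carrier → A'.carrier),
      A.IsCA ∧ A'.IsCA ∧ A.Representable ∧ A'.Representable ∧ B.IsCA ∧ B'.IsCA ∧
      IsNeatEmbedding A B Sum.inl eA ∧ IsNeatEmbedding A' B' Sum.inl eA' ∧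
      B.Generates (Set.range eA) ∧ B'.Generates (Set.range eA') ∧
      Function.Bijective i ∧ RawCA.IsHom A A' i ∧
      ¬ ∃ ibar : B.carrier → B'.carrier, Function.Bijective ibar ∧
          RawCA.IsHom B B' ibar ∧ ∀ a, ibar (eA a) = eA' (i a)) := by
  classical
  obtain ⟨p, q, hpq⟩ := exists_pair_ne ι
  have hcaP := isCA_powAlg (ULift.{u} Bool) ι (Base ι)
  have hcaA : (alikeAlg p).IsCA := hcaP.subAlg _
  have hcaB : (dilation (alikeSets p)).IsCA :=
    (isCA_powAlg (ULift.{u} Bool) (ι ⊕ ℕ) (Base ι)).subAlg _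
  have hrepA : (alikeAlg p).Representable := representable_subAlg _
  have hneatA := isNeatEmbedding_dilate (isSubuniverse_alikeSets p)
    (subset_neatClosure (alikeSets p))
  have hgenA := generates_dilation (isSubuniverse_alikeSets p)
    (subset_neatClosure (alikeSets p)) subset_rfl
  have hb : dilate (asymmetric p q) ≠ (Square ι (ι ⊕ ℕ)).zero := fun h =>
    asymmetric_ne_zero hpq (dilate_injective h)
  have hb₀ : coord (dilate (asymmetric p q)) ⟨false⟩ = ∅ := by
    refine Set.eq_empty_of_forall_notMem fun s hs => ?_
    have hs : s ∘ Sum.inl ∈ coord (asymmetric p q) ⟨false⟩ := hs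
    rwa [coord_asymmetric_false hpq] at hs
  refine ⟨?_, ?_, ?_⟩
  · refine ⟨alikeAlg p, neatAlg p, dilation (alikeSets p), _, _, hcaA, hcaP.subAlg _, hrepA,
      representable_subAlg _, hcaB, hneatA, isNeatEmbedding_dilate _ fun _ h => h, hgenA,
      generates_dilation (isSubuniverse_neatClosure _) (fun _ h => h) (subset_neatClosure _), ?_⟩
    rintro ⟨g, hg, hhom⟩
    exact not_hasDiscreteTriple_alikeAlg p ((hasDiscreteTriple_neatAlg hpq).of_iso hg hhom)
  · refine ⟨alikeAlg p, dilation (alikeSets p), _, firstKernel p, hcaA, hrepA, hcaB, hneatA,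
      hgenA, isIdeal_firstKernel p, fun h => hb ?_⟩
    have hmem : (⟨dilate (asymmetric p q), asymmetric_mem hpq⟩ :
        (dilation (alikeSets p)).carrier) ∈ firstKernel p := hb₀
    rw [← h] at hmem
    refine congrArg Subtype.val (Set.mem_singleton_iff.1 (hmem _ hcaB.isIdeal_zero ?_))
    rintro _ ⟨hY₀, Y, rfl⟩
    refine Subtype.ext ?_
    change dilate Y.1 = dilate (Square ι ι).zero
    rw [coord_dilate_injective p Y.2 (isSubuniverse_alikeSets p).zero hY₀]
  · refine ⟨alikeAlg p, alikeAlg p, dilation (alikeSets p), firstDilation p, _,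
      toFirstDilation p, id, hcaA, hcaA, hrepA, hrepA, hcaB,
      (isCA_fullSetAlg _ _).subAlg (RawCA.isSubuniverse_inSubalg _ _), hneatA,
      isNeatEmbedding_toFirstDilation p, hgenA, generates_toFirstDilation p, Function.bijective_id,
      ⟨fun _ _ => rfl, fun _ _ => rfl, fun _ => rfl, rfl, rfl, fun _ _ => rfl, fun _ _ => rfl⟩, ?_⟩
    rintro ⟨g, hg, hhom, h⟩
    refine hb (congrArg Subtype.val (@hg.1 ⟨dilate (asymmetric p q), asymmetric_mem hpq⟩
      (dilation (alikeSets p)).zero (Subtype.ext ?_)))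
    exact (eq_coord_of_isHom hhom h _).trans
      (hb₀.trans (eq_coord_of_isHom hhom h (dilation (alikeSets p)).zero).symm)
end
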